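/- arXiv:0811.2103 — 4 statements merged into one kernel-verified Lean document; each statement's English description precedes it below -/
import Mathlib

section
/- Let Ω ⊆ ℝ^D be open, H = a·∇ a C^∞ vector field on Ω with a(x) ≠ 0 for all x ∈ Ω, and Σ a C^∞ hypersurface of Ω that is closed as a subset of Ω. Let μ and ν be N×N matrix-valued Radon measures on Ω, let b, c : Ω → ℂ^{N×N} be C^∞, suppose Hμ + bμ + μc = ν holds in the sense of distributions, that ν is absolutely continuous with respect to μ, and that supp ν ⊆ Σ. Then 1_{Σ(0;H)} μ = 0 and 1_{Σ(0;H)} ν = 0, where Σ(0;H) is the set of points of Σ at which H is transverse to Σ. -/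
noncomputable section
open Topology MeasureTheory


/-- The directional derivative `(Hf)(x) = a(x)·∇f(x)` of `f` along the vector field `a`. -/
def vfDeriv {D : ℕ} (a : (Fin D → ℝ) → (Fin D → ℝ)) (f : (Fin D → ℝ) → ℝ) :
    (Fin D → ℝ) → ℝ :=
  fun x => fderiv ℝ f x (a x)

/-- The iterate `H^k f` of the vector field `H = a·∇` applied to `f`. -/
def vfIter {D : ℕ} (a : (Fin D → ℝ) → (Fin D → ℝ)) :
    ℕ → ((Fin D → ℝ) → ℝ) → ((Fin D → ℝ) → ℝ)
  | 0, f => f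
  | k + 1, f => vfDeriv a (vfIter a k f)

/-- `γ` is a local defining function, on the open set `U ⊆ Ω`, for the hypersurface `S` of `Ω`. -/
def IsLocalDefining {D : ℕ} (Ω S U : Set (Fin D → ℝ)) (γ : (Fin D → ℝ) → ℝ) : Prop :=
  IsOpen U ∧ U ⊆ Ω ∧ ContDiffOn ℝ (⊤ : ℕ∞) γ U ∧ (∀ y ∈ U, fderiv ℝ γ y ≠ 0) ∧
    S ∩ U = {y ∈ U | γ y = 0}

/-- `S` is a `C^∞` hypersurface of the open set `Ω`. -/
def IsHypersurface {D : ℕ} (Ω S : Set (Fin D → ℝ)) : Prop :=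
  S ⊆ Ω ∧ ∀ x ∈ S, ∃ U γ, IsLocalDefining Ω S U γ ∧ x ∈ U

/-- The set `Σ(k;H)` of points of `S` where the vector field `H = a·∇` has contact of
exact order `k` with `S` (for `k = 0`, `H` is transverse to `S`). -/
def contactSet {D : ℕ} (a : (Fin D → ℝ) → (Fin D → ℝ)) (Ω S : Set (Fin D → ℝ)) (k : ℕ) :
    Set (Fin D → ℝ) :=
  {x | x ∈ S ∧ ∃ U γ, IsLocalDefining Ω S U γ ∧ x ∈ U ∧
    (∀ i, 1 ≤ i → i ≤ k → vfIter a i γ x = 0) ∧ vfIter a (k + 1) γ x ≠ 0}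

/-- The set `Σ(∞;H)` of points of `S` where `H = a·∇` is tangent to `S` at infinite order. -/
def contactInf {D : ℕ} (a : (Fin D → ℝ) → (Fin D → ℝ)) (Ω S : Set (Fin D → ℝ)) :
    Set (Fin D → ℝ) :=
  {x | x ∈ S ∧ ∃ U γ, IsLocalDefining Ω S U γ ∧ x ∈ U ∧
    ∀ i, 1 ≤ i → vfIter a i γ x = 0}

/-- The transfinite family `F(α;H;Σ)` of Definition 3.3. -/
def Fset {D : ℕ} (a : (Fin D → ℝ) → (Fin D → ℝ)) (Ω S : Set (Fin D → ℝ)) (α : Ordinal) :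
    Set (Fin D → ℝ) :=
  Ordinal.limitRecOn α (contactInf a Ω S)
    (fun _β Fβ => Fβ \ {x | ∃ U Θ, IsOpen U ∧ x ∈ U ∧ U ⊆ Ω ∧ IsHypersurface U Θ ∧
        Fβ ∩ U ⊆ Θ ∧ ∃ k : ℕ, x ∈ contactSet a U Θ k})
    (fun _α _ IH => ⋂ (β) (h : _), IH β h)

/-- An `N×N` matrix of (locally finite, complex) Radon measures on the open set `Ω ⊆ ℝ^D`.
Each entry `μ_{pq}` is encoded by its polar decomposition: a positive Borel measure
`ρ p q` (the total variation `|μ_{pq}|`), locally finite on `Ω` and carried by `Ω`,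
together with a measurable density `dens p q` of modulus one, so that
`μ_{pq}(B) = ∫_B dens p q ∂(ρ p q)`. -/
structure MatRadonMeasure (D N : ℕ) (Ω : Set (Fin D → ℝ)) where
  ρ : Fin N → Fin N → Measure (Fin D → ℝ)
  dens : Fin N → Fin N → (Fin D → ℝ) → ℂ
  locFin : ∀ p q, ∀ x ∈ Ω, ∃ U, IsOpen U ∧ x ∈ U ∧ ρ p q U < ⊤
  carried : ∀ p q, ρ p q Ωᶜ = 0
  meas_dens : ∀ p q, Measurable (dens p q)
  norm_dens : ∀ p q x, ‖dens p q x‖ = 1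

namespace MatRadonMeasure

variable {D N : ℕ} {Ω : Set (Fin D → ℝ)}

/-- The value `μ_{pq}(B)` of the entry measure on a Borel set `B`. -/
def entry (μ : MatRadonMeasure D N Ω) (p q : Fin N) (B : Set (Fin D → ℝ)) : ℂ :=
  ∫ x in B, μ.dens p q x ∂(μ.ρ p q)

/-- `tr ∫ ψ dμ = Σ_{p,q} ∫ ψ_{qp} dμ_{pq}`. -/
def trInt (μ : MatRadonMeasure D N Ω) (ψ : (Fin D → ℝ) → Fin N → Fin N → ℂ) : ℂ :=
  ∑ p, ∑ q, ∫ x, ψ x q p * μ.dens p q x ∂(μ.ρ p q)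

/-- `1_S μ = 0` : every Borel subset of `S` is null for every entry of `μ`. -/
def VanishesOn (μ : MatRadonMeasure D N Ω) (S : Set (Fin D → ℝ)) : Prop :=
  ∀ p q, ∀ B ⊆ S, MeasurableSet B → μ.entry p q B = 0

/-- The support of `μ` : the complement in `Ω` of the largest open set
on which all entries of `μ` vanish. -/
def support (μ : MatRadonMeasure D N Ω) : Set (Fin D → ℝ) :=
  {x | x ∈ Ω ∧ ∀ V, IsOpen V → x ∈ V → ¬ μ.VanishesOn V}

/-- `ν` is absolutely continuous with respect to `μ` : any Borel set null for `|μ_{pq}|`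
for all `p, q` is also null for `|ν_{pq}|` for all `p, q`. -/
def AC (ν μ : MatRadonMeasure D N Ω) : Prop :=
  ∀ B, MeasurableSet B → (∀ p q, μ.ρ p q B = 0) → ∀ p q, ν.ρ p q B = 0

end MatRadonMeasure

/-- The divergence `div a = Σ_l ∂a_l/∂x_l` of the vector field `a`. -/
def divergence {D : ℕ} (a : (Fin D → ℝ) → (Fin D → ℝ)) (x : Fin D → ℝ) : ℝ :=
  ∑ l, fderiv ℝ (fun y => a y l) x (Pi.single l 1)

/-- The equation `Hμ + bμ + μc = ν` in the sense of distributions on `Ω`, where `H = a·∇`: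
for every smooth compactly supported matrix-valued `φ` with support in `Ω`,
`−tr∫ (a·∇φ + (div a)φ) dμ + tr∫ φb dμ + tr∫ cφ dμ = tr∫ φ dν`. -/
def DistribEq {D N : ℕ} {Ω : Set (Fin D → ℝ)} (a : (Fin D → ℝ) → (Fin D → ℝ))
    (b c : (Fin D → ℝ) → Fin N → Fin N → ℂ) (μ ν : MatRadonMeasure D N Ω) : Prop :=
  ∀ φ : (Fin D → ℝ) → Fin N → Fin N → ℂ,
    ContDiff ℝ (⊤ : ℕ∞) φ → HasCompactSupport φ → tsupport φ ⊆ Ω →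
    - μ.trInt (fun x q p => fderiv ℝ (fun y => φ y q p) x (a x)
          + (divergence a x : ℂ) * φ x q p)
      + μ.trInt (fun x q p => ∑ r, φ x q r * b x r p)
      + μ.trInt (fun x q p => ∑ r, c x q r * φ x r p)
      = ν.trInt φ

open Filter

lemma MatRadonMeasure.compact_lt_top {D N : ℕ} {Ω : Set (Fin D → ℝ)}
    (μ : MatRadonMeasure D N Ω) (p q : Fin N) {K : Set (Fin D → ℝ)} (hK : IsCompact K)
    (hKΩ : K ⊆ Ω) : μ.ρ p q K < ⊤ := by
  apply hK.measure_lt_top_of_nhdsWithin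
  intro x hx
  obtain ⟨U, hU, hxU, hlt⟩ := μ.locFin p q x (hKΩ hx)
  exact ⟨U, mem_nhdsWithin_of_mem_nhds (hU.mem_nhds hxU), hlt⟩

lemma trInt_tendsto {D N : ℕ} {Ω : Set (Fin D → ℝ)}
    (μ : MatRadonMeasure D N Ω) {K : Set (Fin D → ℝ)} (hK : IsCompact K) (hKΩ : K ⊆ Ω)
    (ψ : ℕ → (Fin D → ℝ) → Fin N → Fin N → ℂ) (ψ0 : (Fin D → ℝ) → Fin N → Fin N → ℂ)
    (hcont : ∀ n q p, ContinuousOn (fun x => ψ n x q p) K)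
    (hz : ∀ n q p x, x ∉ K → ψ n x q p = 0)
    (hz0 : ∀ q p x, x ∉ K → ψ0 x q p = 0)
    (G : (Fin D → ℝ) → Fin N → Fin N → ℝ)
    (hG : ∀ q p, ContinuousOn (fun x => G x q p) K)
    (hb : ∀ n q p, ∀ x ∈ K, ‖ψ n x q p‖ ≤ G x q p)
    (hl : ∀ q p, ∀ x ∈ K, Tendsto (fun n => ψ n x q p) atTop (𝓝 (ψ0 x q p))) :
    Tendsto (fun n => μ.trInt (ψ n)) atTop (𝓝 (μ.trInt ψ0)) := by
  unfold MatRadonMeasure.trInt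
  refine tendsto_finsetSum _ fun p _ => tendsto_finsetSum _ fun q _ => ?_
  have hfin := μ.compact_lt_top p q hK hKΩ
  have hKm : MeasurableSet K := hK.isClosed.measurableSet
  have e : ∀ f : (Fin D → ℝ) → ℂ, (∀ x, x ∉ K → f x = 0) →
      ∫ x, f x * μ.dens p q x ∂(μ.ρ p q) = ∫ x in K, f x * μ.dens p q x ∂(μ.ρ p q) := by
    intro f hf
    rw [setIntegral_eq_integral_of_forall_compl_eq_zero]
    intro x hx
    rw [hf x hx, zero_mul]
  rw [e _ (hz0 q p)]
  simp_rw [fun n => e _ (hz n q p)]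
  have : IsFiniteMeasure ((μ.ρ p q).restrict K) := ⟨by simpa using hfin⟩
  refine tendsto_integral_of_dominated_convergence (fun x => G x q p) ?_ ?_ ?_ ?_
  · intro n
    exact ((hcont n q p).aestronglyMeasurable hKm).mul
      (μ.meas_dens p q).aestronglyMeasurable
  · obtain ⟨C, hC⟩ := hK.exists_bound_of_continuousOn (hG q p)
    refine Integrable.of_bound ((hG q p).aestronglyMeasurable hKm) C ?_
    exact (ae_restrict_iff' hKm).2 (Eventually.of_forall hC)
  · intro n
    refine (ae_restrict_iff' hKm).2 (Eventually.of_forall fun x hx => ?_)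
    rw [norm_mul, μ.norm_dens, mul_one]
    exact hb n q p x hx
  · refine (ae_restrict_iff' hKm).2 (Eventually.of_forall fun x hx => ?_)
    exact (hl q p x hx).mul_const _

/-- The profile `t ↦ arctan((n+1)t)/(n+1)`. -/
def prof (n : ℕ) (t : ℝ) : ℝ := Real.arctan (((n : ℝ) + 1) * t) / ((n : ℝ) + 1)

lemma prof_contDiff (n : ℕ) : ContDiff ℝ (⊤ : ℕ∞) (prof n) := by
  unfold prof
  exact (Real.contDiff_arctan.comp (contDiff_const.mul contDiff_id)).div_const _

lemma prof_hasDerivAt (n : ℕ) (t : ℝ) :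
    HasDerivAt (prof n) (1 / (1 + (((n : ℝ) + 1) * t) ^ 2)) t := by
  have hn : ((n : ℝ) + 1) ≠ 0 := by positivity
  have h := (((hasDerivAt_id t).const_mul ((n : ℝ) + 1)).arctan).div_const ((n : ℝ) + 1)
  refine h.congr_deriv ?_
  simp only [id]
  field_simp

lemma prof_abs_le (n : ℕ) (t : ℝ) : |prof n t| ≤ 2 / ((n : ℝ) + 1) := by
  unfold prof
  rw [abs_div, abs_of_pos (by positivity : (0 : ℝ) < (n : ℝ) + 1)]
  gcongr
  have h1 := Real.arctan_lt_pi_div_two (((n : ℝ) + 1) * t)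
  have h2 := Real.neg_pi_div_two_lt_arctan (((n : ℝ) + 1) * t)
  have h3 := Real.pi_le_four
  rw [abs_le]; constructor <;> linarith

lemma prof_abs_le_two (n : ℕ) (t : ℝ) : |prof n t| ≤ 2 :=
  (prof_abs_le n t).trans (div_le_self (by norm_num) (by
    have : (0 : ℝ) ≤ n := Nat.cast_nonneg n
    linarith))

lemma tendsto_add_one : Tendsto (fun n : ℕ => (n : ℝ) + 1) atTop atTop :=
  tendsto_atTop_add_const_right _ _ tendsto_natCast_atTop_atTop

lemma prof_tendsto (t : ℝ) : Tendsto (fun n => prof n t) atTop (𝓝 0) :=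
  squeeze_zero_norm (fun n => prof_abs_le n t) (tendsto_const_nhds.div_atTop tendsto_add_one)

lemma profd_tendsto (t : ℝ) : Tendsto (fun n : ℕ => 1 / (1 + (((n : ℝ) + 1) * t) ^ 2)) atTop
    (𝓝 (if t = 0 then 1 else 0)) := by
  split_ifs with h
  · simp [h]
  · refine tendsto_const_nhds.div_atTop ?_
    refine tendsto_atTop_add_const_left _ _ ?_
    simp_rw [mul_pow]
    exact ((tendsto_pow_atTop (two_ne_zero)).comp tendsto_add_one).atTop_mul_const (by positivity)

lemma profd_abs_le (n : ℕ) (t : ℝ) : |1 / (1 + (((n : ℝ) + 1) * t) ^ 2)| ≤ 1 := by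
  rw [abs_of_pos (by positivity)]
  rw [div_le_one (by positivity)]
  nlinarith [sq_nonneg (((n : ℝ) + 1) * t)]

/-- The localised test function. -/
def tf {D : ℕ} (χ γ : (Fin D → ℝ) → ℝ) (n : ℕ) (x : Fin D → ℝ) : ℝ := χ x * prof n (γ x)

lemma tf_contDiff {D : ℕ} {χ γ : (Fin D → ℝ) → ℝ} {U : Set (Fin D → ℝ)} (hU : IsOpen U)
    (hχ : ContDiff ℝ (⊤ : ℕ∞) χ) (hχU : tsupport χ ⊆ U) (hγ : ContDiffOn ℝ (⊤ : ℕ∞) γ U) (n : ℕ) :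
    ContDiff ℝ (⊤ : ℕ∞) (tf χ γ n) := by
  rw [contDiff_iff_contDiffAt]
  intro x
  by_cases hx : x ∈ tsupport χ
  · exact hχ.contDiffAt.mul
      ((prof_contDiff n).contDiffAt.comp x (hγ.contDiffAt (hU.mem_nhds (hχU hx))))
  · have : tf χ γ n =ᶠ[𝓝 x] fun _ => 0 := by
      filter_upwards [notMem_tsupport_iff_eventuallyEq.1 hx] with y hy
      simp [tf, hy]
    exact contDiffAt_const.congr_of_eventuallyEq this

lemma tf_tsupport {D : ℕ} (χ γ : (Fin D → ℝ) → ℝ) (n : ℕ) : tsupport (tf χ γ n) ⊆ tsupport χ := by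
  apply closure_mono
  intro x hx h
  exact hx (by simp [tf, h])

lemma tf_fderiv {D : ℕ} {χ γ : (Fin D → ℝ) → ℝ} {U : Set (Fin D → ℝ)} (hU : IsOpen U)
    (hχ : ContDiff ℝ (⊤ : ℕ∞) χ) (hγ : ContDiffOn ℝ (⊤ : ℕ∞) γ U) (n : ℕ)
    {x : Fin D → ℝ} (hx : x ∈ U) (v : Fin D → ℝ) :
    fderiv ℝ (tf χ γ n) x v = fderiv ℝ χ x v * prof n (γ x)
      + χ x * ((1 / (1 + (((n : ℝ) + 1) * γ x) ^ 2)) * fderiv ℝ γ x v) := by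
  have h1 : HasFDerivAt χ (fderiv ℝ χ x) x := (hχ.differentiable (by simp) x).hasFDerivAt
  have h2 : HasFDerivAt γ (fderiv ℝ γ x) x :=
    ((hγ.contDiffAt (hU.mem_nhds hx)).differentiableAt (by simp)).hasFDerivAt
  have h3 := (prof_hasDerivAt n (γ x)).comp_hasFDerivAt x h2
  have h4 := h1.mul h3
  have h5 : tf χ γ n = χ * (prof n ∘ γ) := rfl
  rw [h5, h4.fderiv]
  simp
  ring

lemma key {D N : ℕ} {Ω U : Set (Fin D → ℝ)} (hΩ : IsOpen Ω)
    (a : (Fin D → ℝ) → (Fin D → ℝ)) (ha : ContDiffOn ℝ (⊤ : ℕ∞) a Ω)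
    (b c : (Fin D → ℝ) → Fin N → Fin N → ℂ)
    (hb : ContDiffOn ℝ (⊤ : ℕ∞) b Ω) (hc : ContDiffOn ℝ (⊤ : ℕ∞) c Ω)
    (μ ν : MatRadonMeasure D N Ω)
    (heq : DistribEq a b c μ ν) (γ : (Fin D → ℝ) → ℝ) (hU : IsOpen U) (hUΩ : U ⊆ Ω)
    (hγ : ContDiffOn ℝ (⊤ : ℕ∞) γ U) (χ : (Fin D → ℝ) → ℝ)
    (hχ : ContDiff ℝ (⊤ : ℕ∞) χ) (hχc : HasCompactSupport χ) (hχU : tsupport χ ⊆ U)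
    (i j : Fin N) :
    ∫ x, ((χ x * ((if γ x = 0 then 1 else 0) * fderiv ℝ γ x (a x)) : ℝ) : ℂ)
      * μ.dens j i x ∂(μ.ρ j i) = 0 := by
  set K := tsupport χ with hKdef
  have hK : IsCompact K := hχc
  have hKΩ : K ⊆ Ω := hχU.trans hUΩ
  set E : Fin N → Fin N → ℂ := fun q p => if q = i ∧ p = j then 1 else 0 with hE
  have hEn : ∀ q p, ‖E q p‖ ≤ 1 := by
    intro q p
    simp only [hE]; split_ifs <;> simp
  set u : ℕ → (Fin D → ℝ) → ℝ := tf χ γ with hu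
  have hucd : ∀ n, ContDiff ℝ (⊤ : ℕ∞) (u n) := tf_contDiff hU hχ hχU hγ
  have hχ0 : ∀ x, x ∉ K → χ x = 0 := fun x hx => image_eq_zero_of_notMem_tsupport hx
  have hu0 : ∀ n x, x ∉ K → u n x = 0 := fun n x hx => by simp [hu, tf, hχ0 x hx]
  have hdu0 : ∀ n x, x ∉ K → fderiv ℝ (u n) x = 0 := fun n x hx => by
    have : x ∉ tsupport (u n) := fun h => hx (tf_tsupport χ γ n h)
    exact fderiv_of_notMem_tsupport ℝ this
  have hub : ∀ n x, |u n x| ≤ |χ x| * 2 := fun n x => by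
    simp only [hu, tf, abs_mul]
    exact mul_le_mul_of_nonneg_left (prof_abs_le_two _ _) (abs_nonneg _)
  have hul : ∀ x, Tendsto (fun n => u n x) atTop (𝓝 0) := fun x => by
    simpa [hu, tf] using (prof_tendsto (γ x)).const_mul (χ x)
  have hacont : ContinuousOn a K := ha.continuousOn.mono hKΩ
  have hdiv : ContinuousOn (divergence a) K := by
    refine ContinuousOn.mono ?_ hKΩ
    unfold divergence
    refine continuousOn_finsetSum _ fun l _ => ?_
    have h1 : ContDiffOn ℝ (⊤ : ℕ∞) (fun y => a y l) Ω := (contDiffOn_pi.1 ha) l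
    exact (h1.continuousOn_fderiv_of_isOpen hΩ (by simp)).clm_apply continuousOn_const
  have hχcont : ContinuousOn (fun x => |χ x| * 2) K := by
    have := hχ.continuous
    fun_prop
  have hbc : ∀ q p, ContinuousOn (fun x => b x q p) K := fun q p =>
    ((contDiffOn_pi.1 ((contDiffOn_pi.1 hb) q)) p).continuousOn.mono hKΩ
  have hcc : ∀ q p, ContinuousOn (fun x => c x q p) K := fun q p =>
    ((contDiffOn_pi.1 ((contDiffOn_pi.1 hc) q)) p).continuousOn.mono hKΩ
  set φ : ℕ → (Fin D → ℝ) → Fin N → Fin N → ℂ := fun n x q p => (u n x : ℂ) * E q p with hφ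
  have hucC : ∀ n, ContDiff ℝ (⊤ : ℕ∞) (fun x => (u n x : ℂ)) := fun n =>
    Complex.ofRealCLM.contDiff.comp (hucd n)
  have hφcd : ∀ n, ContDiff ℝ (⊤ : ℕ∞) (φ n) := fun n =>
    contDiff_pi.2 fun q => contDiff_pi.2 fun p => (hucC n).mul contDiff_const
  have hφs : ∀ n, tsupport (φ n) ⊆ K := fun n => by
    refine closure_minimal ?_ (isClosed_tsupport χ)
    intro x hx
    by_contra hxK
    refine hx ?_
    funext q p
    simp [hφ, hu0 n x hxK]
  have hφc : ∀ n, HasCompactSupport (φ n) := fun n =>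
    hK.of_isClosed_subset (isClosed_tsupport _) (hφs n)
  have hEq := fun n => heq (φ n) (hφcd n) (hφc n) ((hφs n).trans hKΩ)
  have hφb : ∀ n x q p, ‖φ n x q p‖ ≤ |χ x| * 2 := fun n x q p => by
    simp only [hφ, norm_mul, Complex.norm_real, Real.norm_eq_abs]
    calc _ ≤ (|χ x| * 2) * 1 := mul_le_mul (hub n x) (hEn q p) (norm_nonneg _) (by positivity)
      _ = _ := mul_one _
  have hφl : ∀ x q p, Tendsto (fun n => φ n x q p) atTop (𝓝 0) := fun x q p => by
    have h1 : Tendsto (fun n => (u n x : ℂ)) atTop (𝓝 ((0 : ℝ) : ℂ)) :=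
      (Complex.continuous_ofReal.tendsto _).comp (hul x)
    simpa [hφ] using h1.mul_const (E q p)
  have hφcont : ∀ n q p, Continuous (fun x => φ n x q p) := fun n q p =>
    (hucC n).continuous.mul continuous_const
  have hφ0 : ∀ n x q p, x ∉ K → φ n x q p = 0 := fun n x q p hx => by
    simp [hφ, hu0 n x hx]
  have hfd : ∀ n x q p, fderiv ℝ (fun y => φ n y q p) x (a x)
      = ((fderiv ℝ (u n) x (a x) : ℝ) : ℂ) * E q p := by
    intro n x q p
    have h1 : HasFDerivAt (u n) (fderiv ℝ (u n) x) x :=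
      ((hucd n).differentiable (by simp) x).hasFDerivAt
    have h2 := (Complex.ofRealCLM.hasFDerivAt.comp x h1).mul_const (E q p)
    have h3 : (fun y => φ n y q p) = fun y => (Complex.ofRealCLM ∘ u n) y * E q p := rfl
    rw [h3, h2.fderiv]
    simp [mul_comm]
  have htr0 : ∀ m : MatRadonMeasure D N Ω, m.trInt (fun _ _ _ => 0) = 0 := by
    intro m; simp [MatRadonMeasure.trInt]
  -- the four limits
  have L4 : Tendsto (fun n => ν.trInt (φ n)) atTop (𝓝 0) := by
    rw [← htr0 ν]
    exact trInt_tendsto ν hK hKΩ φ _ (fun n q p => (hφcont n q p).continuousOn)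
      (fun n q p x hx => hφ0 n x q p hx) (fun _ _ _ _ => rfl) (fun x _ _ => |χ x| * 2)
      (fun _ _ => hχcont) (fun n q p x _ => hφb n x q p) (fun q p x _ => hφl x q p)
  have L2 : Tendsto (fun n => μ.trInt (fun x q p => ∑ r, φ n x q r * b x r p)) atTop (𝓝 0) := by
    rw [← htr0 μ]
    refine trInt_tendsto μ hK hKΩ _ _ ?_ ?_ (fun _ _ _ _ => rfl)
      (fun x q p => ∑ r, |χ x| * 2 * ‖b x r p‖) ?_ ?_ ?_
    · intro n q p
      exact continuousOn_finsetSum _ fun r _ => (hφcont n q r).continuousOn.mul (hbc r p)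
    · intro n q p x hx
      exact Finset.sum_eq_zero fun r _ => by rw [hφ0 n x q r hx, zero_mul]
    · intro q p
      exact continuousOn_finsetSum _ fun r _ => hχcont.mul (hbc r p).norm
    · intro n q p x _
      refine norm_sum_le_of_le _ fun r _ => ?_
      rw [norm_mul]
      exact mul_le_mul_of_nonneg_right (hφb n x q r) (norm_nonneg _)
    · intro q p x _
      have := tendsto_finsetSum Finset.univ
        fun r (_ : r ∈ Finset.univ) => (hφl x q r).mul_const (b x r p)
      simpa using this
  have L3 : Tendsto (fun n => μ.trInt (fun x q p => ∑ r, c x q r * φ n x r p)) atTop (𝓝 0) := by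
    rw [← htr0 μ]
    refine trInt_tendsto μ hK hKΩ _ _ ?_ ?_ (fun _ _ _ _ => rfl)
      (fun x q p => ∑ r, ‖c x q r‖ * (|χ x| * 2)) ?_ ?_ ?_
    · intro n q p
      exact continuousOn_finsetSum _ fun r _ => (hcc q r).mul (hφcont n r p).continuousOn
    · intro n q p x hx
      exact Finset.sum_eq_zero fun r _ => by rw [hφ0 n x r p hx, mul_zero]
    · intro q p
      exact continuousOn_finsetSum _ fun r _ => (hcc q r).norm.mul hχcont
    · intro n q p x _
      refine norm_sum_le_of_le _ fun r _ => ?_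
      rw [norm_mul]
      exact mul_le_mul_of_nonneg_left (hφb n x r p) (norm_nonneg _)
    · intro q p x _
      have := tendsto_finsetSum Finset.univ
        fun r (_ : r ∈ Finset.univ) => (hφl x r p).const_mul (c x q r)
      simpa using this
  have hdχc : ContinuousOn (fun x => fderiv ℝ χ x (a x)) K :=
    ((hχ.continuous_fderiv (by simp)).continuousOn).clm_apply hacont
  have hdγc : ContinuousOn (fun x => fderiv ℝ γ x (a x)) K :=
    ((hγ.continuousOn_fderiv_of_isOpen hU (by simp)).mono hχU).clm_apply hacont
  have L1 : Tendsto (fun n => μ.trInt (fun x q p => fderiv ℝ (fun y => φ n y q p) x (a x)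
          + (divergence a x : ℂ) * φ n x q p)) atTop
      (𝓝 (μ.trInt (fun x q p =>
        ((χ x * ((if γ x = 0 then 1 else 0) * fderiv ℝ γ x (a x)) : ℝ) : ℂ) * E q p))) := by
    simp_rw [hfd]
    refine trInt_tendsto μ hK hKΩ _ _ ?_ ?_ ?_
      (fun x q p => (|fderiv ℝ χ x (a x)| * 2 + |χ x| * (1 * |fderiv ℝ γ x (a x)|))
        + |divergence a x| * (|χ x| * 2)) ?_ ?_ ?_
    · intro n q p
      have h1 : ContinuousOn (fun x => fderiv ℝ (u n) x (a x)) K :=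
        (((hucd n).continuous_fderiv (by simp)).continuousOn).clm_apply hacont
      exact ((Complex.continuous_ofReal.comp_continuousOn h1).mul continuousOn_const).add
        ((Complex.continuous_ofReal.comp_continuousOn hdiv).mul (hφcont n q p).continuousOn)
    · intro n q p x hx
      simp [hdu0 n x hx, hφ0 n x q p hx]
    · intro q p x hx
      simp [hχ0 x hx]
    · intro q p
      exact ((hdχc.abs.mul continuousOn_const).add (hχ.continuous.continuousOn.abs.mul
        (continuousOn_const.mul hdγc.abs))).add (hdiv.abs.mul hχcont)
    · intro n q p x hx
      refine (norm_add_le _ _).trans (add_le_add ?_ ?_)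
      · rw [norm_mul, Complex.norm_real, Real.norm_eq_abs]
        refine (mul_le_of_le_one_right (abs_nonneg _) (hEn q p)).trans ?_
        rw [hu, tf_fderiv hU hχ hγ n (hχU hx)]
        refine (abs_add_le _ _).trans (add_le_add ?_ ?_)
        · rw [abs_mul]
          exact mul_le_mul_of_nonneg_left (prof_abs_le_two _ _) (abs_nonneg _)
        · rw [abs_mul, abs_mul]
          exact mul_le_mul_of_nonneg_left
            (mul_le_mul_of_nonneg_right (profd_abs_le _ _) (abs_nonneg _)) (abs_nonneg _)
      · rw [norm_mul, Complex.norm_real, Real.norm_eq_abs]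
        exact mul_le_mul_of_nonneg_left (hφb n x q p) (abs_nonneg _)
    · intro q p x hx
      have h1 : Tendsto (fun n => fderiv ℝ (u n) x (a x)) atTop
          (𝓝 (χ x * ((if γ x = 0 then 1 else 0) * fderiv ℝ γ x (a x)))) := by
        simp_rw [hu, fun n => tf_fderiv hU hχ hγ n (hχU hx)]
        have := ((prof_tendsto (γ x)).const_mul (fderiv ℝ χ x (a x))).add
          (((profd_tendsto (γ x)).mul_const (fderiv ℝ γ x (a x))).const_mul (χ x))
        rwa [mul_zero, zero_add] at this
      have h2 := (((Complex.continuous_ofReal.tendsto _).comp h1).mul_const (E q p)).add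
        ((hφl x q p).const_mul (divergence a x : ℂ))
      rw [mul_zero, add_zero] at h2
      exact h2
  have L := (L1.neg.add L2).add L3
  have huniq := tendsto_nhds_unique (L.congr hEq) L4
  rw [add_zero, add_zero, neg_eq_zero] at huniq
  unfold MatRadonMeasure.trInt at huniq
  rw [Finset.sum_eq_single j, Finset.sum_eq_single i] at huniq
  · simpa [hE] using huniq
  · intro q _ hq
    simp [hE, hq]
  · simp
  · intro p _ hp
    simp [hE, hp]
  · simp

lemma local_null {D N : ℕ} {Ω U : Set (Fin D → ℝ)} (hΩ : IsOpen Ω)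
    (a : (Fin D → ℝ) → (Fin D → ℝ)) (ha : ContDiffOn ℝ (⊤ : ℕ∞) a Ω)
    (b c : (Fin D → ℝ) → Fin N → Fin N → ℂ)
    (hb : ContDiffOn ℝ (⊤ : ℕ∞) b Ω) (hc : ContDiffOn ℝ (⊤ : ℕ∞) c Ω)
    (μ ν : MatRadonMeasure D N Ω)
    (heq : DistribEq a b c μ ν) (γ : (Fin D → ℝ) → ℝ) (hU : IsOpen U) (hUΩ : U ⊆ Ω)
    (hγ : ContDiffOn ℝ (⊤ : ℕ∞) γ U) (p q : Fin N) :
    μ.ρ p q {x | x ∈ U ∧ γ x = 0 ∧ fderiv ℝ γ x (a x) ≠ 0} = 0 := by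
  set f : (Fin D → ℝ) → ℂ := fun x =>
    (((if γ x = 0 then 1 else 0) * fderiv ℝ γ x (a x) : ℝ) : ℂ) * μ.dens p q x with hf
  have hdγc : ContinuousOn (fun x => fderiv ℝ γ x (a x)) U :=
    (hγ.continuousOn_fderiv_of_isOpen hU (by simp)).clm_apply (ha.continuousOn.mono hUΩ)
  have hloc : LocallyIntegrableOn f U (μ.ρ p q) := by
    rw [locallyIntegrableOn_iff hU.isLocallyClosed]
    intro k hkU hk
    have hkm : MeasurableSet k := hk.isClosed.measurableSet
    have : IsFiniteMeasure ((μ.ρ p q).restrict k) :=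
      ⟨by simpa using μ.compact_lt_top p q hk (hkU.trans hUΩ)⟩
    obtain ⟨C, hC⟩ := hk.exists_bound_of_continuousOn (hdγc.mono hkU)
    have hm1 : AEStronglyMeasurable (fun x => if γ x = 0 then (1 : ℝ) else 0)
        ((μ.ρ p q).restrict k) := by
      have h1 : AEMeasurable γ ((μ.ρ p q).restrict k) :=
        (hγ.continuousOn.mono hkU).aemeasurable hkm
      have h2 : Measurable (fun t : ℝ => if t = 0 then (1 : ℝ) else 0) :=
        Measurable.ite (measurableSet_singleton 0) measurable_const measurable_const
      exact (h2.comp_aemeasurable h1).aestronglyMeasurable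
    refine Integrable.of_bound (C := C) ?_ ?_
    · exact (Complex.continuous_ofReal.comp_aestronglyMeasurable
        (hm1.mul ((hdγc.mono hkU).aestronglyMeasurable hkm))).mul
        (μ.meas_dens p q).aestronglyMeasurable
    · refine (ae_restrict_iff' hkm).2 (Eventually.of_forall fun x hx => ?_)
      rw [hf, norm_mul, μ.norm_dens, mul_one, Complex.norm_real, norm_mul]
      refine (mul_le_of_le_one_left (norm_nonneg _) ?_).trans (hC x hx)
      split_ifs <;> simp
  have hae := hU.ae_eq_zero_of_integral_contDiff_smul_eq_zero hloc (by
    intro g hg hgc hgU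
    have := key hΩ a ha b c hb hc μ ν heq γ hU hUΩ hγ g hg hgc hgU q p
    rw [← this]
    congr 1
    funext x
    rw [hf, Complex.real_smul, Complex.ofReal_mul (g x), mul_assoc])
  refine measure_mono_null ?_ (ae_iff.1 hae)
  rintro x ⟨hxU, hx0, hxn⟩ h
  have h1 := h hxU
  have h2 : μ.dens p q x ≠ 0 := by
    rw [← norm_ne_zero_iff, μ.norm_dens]; exact one_ne_zero
  simp [hf, hx0, hxn, h2] at h1

/-- Lemma 3.5 of the paper: if `Hμ + bμ + μc = ν` distributionally,
`ν ≪ μ` and `supp ν ⊆ Σ`, then `1_{Σ(0;H)} μ = 0` and `1_{Σ(0;H)} ν = 0`. -/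
theorem transversal_vanishing
    {D N : ℕ} (hD : 1 ≤ D) (Ω S : Set (Fin D → ℝ)) (hΩ : IsOpen Ω)
    (a : (Fin D → ℝ) → (Fin D → ℝ)) (ha : ContDiffOn ℝ (⊤ : ℕ∞) a Ω)
    (ha0 : ∀ x ∈ Ω, a x ≠ 0)
    (hS : IsHypersurface Ω S) (hScl : closure S ∩ Ω ⊆ S)
    (b c : (Fin D → ℝ) → Fin N → Fin N → ℂ)
    (hb : ContDiffOn ℝ (⊤ : ℕ∞) b Ω) (hc : ContDiffOn ℝ (⊤ : ℕ∞) c Ω)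
    (μ ν : MatRadonMeasure D N Ω)
    (heq : DistribEq a b c μ ν)
    (hac : ν.AC μ)
    (hsupp : ν.support ⊆ S) :
    μ.VanishesOn (contactSet a Ω S 0) ∧ ν.VanishesOn (contactSet a Ω S 0) := by
  have hnull : ∀ p q, μ.ρ p q (contactSet a Ω S 0) = 0 := by
    intro p q
    refine measure_null_of_locally_null _ ?_
    rintro x ⟨hxS, U, γ, ⟨hU, hUΩ, hγ, -, hSU⟩, hxU, -, hxn⟩
    have hxn' : fderiv ℝ γ x (a x) ≠ 0 := hxn
    have hdγc : ContinuousOn (fun x => fderiv ℝ γ x (a x)) U :=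
      (hγ.continuousOn_fderiv_of_isOpen hU (by simp)).clm_apply (ha.continuousOn.mono hUΩ)
    refine ⟨_, inter_mem_nhdsWithin _ (inter_mem (hU.mem_nhds hxU)
      ((hdγc.continuousAt (hU.mem_nhds hxU)).eventually_ne hxn')), ?_⟩
    refine measure_mono_null ?_ (local_null hΩ a ha b c hb hc μ ν heq γ hU hUΩ hγ p q)
    rintro y ⟨hy, hyU, hyn⟩
    have h1 : y ∈ S ∩ U := ⟨hy.1, hyU⟩
    rw [hSU] at h1
    exact ⟨hyU, h1.2, hyn⟩
  refine ⟨fun p q B hB _ => ?_, fun p q B hB hBm => ?_⟩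
  · exact setIntegral_measure_zero _ (measure_mono_null hB (hnull p q))
  · exact setIntegral_measure_zero _
      (hac B hBm (fun p q => measure_mono_null hB (hnull p q)) p q)
end
end

section
/- Let U ⊆ ℝ^D be open, let μ and ν be N×N matrix-valued Radon measures on U, let b, c : U → ℂ^{N×N} be C^∞, and suppose that for every C^∞ compactly supported φ : U → ℂ^{N×N}: −tr∫_U ∂_{x₁}φ dμ + tr∫_U φ b dμ + tr∫_U c φ dμ = tr∫_U φ dν (i.e. ∂_{x₁}μ + bμ + μc = ν distributionally). Let γ : U → ℝ be C^∞ with ∂_{x₁}γ(x) ≥ c₀ for all x ∈ U, for some constant c₀ > 0, and set Σ = {x ∈ U : γ(x) = 0}. If supp ν ⊆ Σ, then 1_Σ μ = 0. -/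
noncomputable section
open Topology MeasureTheory


open Filter Set in
theorem mrm_compact_lt_top {D N : ℕ} {U : Set (Fin D → ℝ)} (μ : MatRadonMeasure D N U)
    (p q : Fin N) {K : Set (Fin D → ℝ)} (hK : IsCompact K) (hKU : K ⊆ U) :
    μ.ρ p q K < ⊤ := by
  refine hK.measure_lt_top_of_nhdsWithin fun x hx => ?_
  obtain ⟨V, hV, hxV, hfin⟩ := μ.locFin p q x (hKU hx)
  exact ⟨V, mem_nhdsWithin_of_mem_nhds (hV.mem_nhds hxV), hfin⟩

theorem mrm_restrict {D N : ℕ} {U : Set (Fin D → ℝ)} (hU : IsOpen U) (μ : MatRadonMeasure D N U)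
    (p q : Fin N) : (μ.ρ p q).restrict U = μ.ρ p q := by
  apply Measure.restrict_eq_self_of_ae_mem
  rw [ae_iff]
  exact μ.carried p q

open Filter Set in
theorem mrm_dct {D N : ℕ} {U : Set (Fin D → ℝ)} (hU : IsOpen U) (μ : MatRadonMeasure D N U)
    {K : Set (Fin D → ℝ)} (hK : IsCompact K) (hKU : K ⊆ U)
    (f : ℕ → (Fin D → ℝ) → ℝ) (h : (Fin D → ℝ) → ℝ)
    (m : (Fin D → ℝ) → Fin N → Fin N → ℂ) (hm : ∀ i j, ContinuousOn (fun x => m x i j) U)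
    (hf : ∀ n, ContinuousOn (f n) U)
    (B : (Fin D → ℝ) → ℝ) (hB : ContinuousOn B U) (hfB : ∀ n, ∀ x ∈ K, |f n x| ≤ B x)
    (hf0 : ∀ n, ∀ x ∉ K, f n x = 0) (hh0 : ∀ x ∉ K, h x = 0)
    (hlim : ∀ x ∈ K, Tendsto (fun n => f n x) atTop (𝓝 (h x))) :
    Tendsto (fun n => μ.trInt (fun x i j => (f n x : ℂ) * m x i j)) atTop
      (𝓝 (μ.trInt (fun x i j => (h x : ℂ) * m x i j))) := by
  unfold MatRadonMeasure.trInt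
  refine tendsto_finsetSum _ fun p _ => tendsto_finsetSum _ fun q _ => ?_
  obtain ⟨C, hC⟩ := hK.exists_bound_of_continuousOn
    ((hB.mono hKU).norm.mul ((hm q p).mono hKU).norm)
  refine tendsto_integral_of_dominated_convergence (K.indicator fun _ => C) ?_ ?_ ?_ ?_
  · intro n
    refine AEStronglyMeasurable.mul ?_ (μ.meas_dens p q).aestronglyMeasurable
    rw [← mrm_restrict hU]
    refine ContinuousOn.aestronglyMeasurable ?_ hU.measurableSet
    exact (Complex.continuous_ofReal.comp_continuousOn (hf n)).mul (hm q p)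
  · rw [integrable_indicator_iff hK.measurableSet]
    exact integrableOn_const (mrm_compact_lt_top μ p q hK hKU).ne
  · intro n
    refine Eventually.of_forall fun x => ?_
    by_cases hx : x ∈ K
    · rw [indicator_of_mem hx, norm_mul, norm_mul, μ.norm_dens, mul_one, Complex.norm_real]
      refine le_trans ?_ ((le_abs_self _).trans (hC x hx))
      exact mul_le_mul_of_nonneg_right (((hfB n x hx)).trans (le_abs_self _)) (norm_nonneg _)
    · simp [hf0 n x hx, hx]
  · refine Eventually.of_forall fun x => ?_
    refine Tendsto.mul_const _ (Tendsto.mul_const _ ?_)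
    by_cases hx : x ∈ K
    · exact (Complex.continuous_ofReal.tendsto _).comp (hlim x hx)
    · simp [hf0 _ x hx, hh0 x hx]

open Filter Set in
theorem mrm_null_off_support {D N : ℕ} {U : Set (Fin D → ℝ)} (ν : MatRadonMeasure D N U)
    (S : Set (Fin D → ℝ)) (hsupp : ν.support ⊆ S) (p q : Fin N) : ν.ρ p q (U \ S) = 0 := by
  refine measure_null_of_locally_null _ fun x hx => ?_
  have hns : x ∉ ν.support := fun h => hx.2 (hsupp h)
  have : ∃ V, IsOpen V ∧ x ∈ V ∧ ν.VanishesOn V := by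
    by_contra hcon
    push Not at hcon
    exact hns ⟨hx.1, hcon⟩
  obtain ⟨V, hV, hxV, hvan⟩ := this
  obtain ⟨W, hW, hxW, hfin⟩ := ν.locFin p q x hx.1
  refine ⟨V ∩ W, mem_nhdsWithin_of_mem_nhds ((hV.inter hW).mem_nhds ⟨hxV, hxW⟩), ?_⟩
  have hVW : MeasurableSet (V ∩ W) := (hV.inter hW).measurableSet
  have hlt : ν.ρ p q (V ∩ W) < ⊤ := (measure_mono inter_subset_right).trans_lt hfin
  haveI : IsFiniteMeasure ((ν.ρ p q).restrict (V ∩ W)) := ⟨by simpa using hlt⟩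
  have hint : Integrable (ν.dens p q) ((ν.ρ p q).restrict (V ∩ W)) :=
    Integrable.of_bound (ν.meas_dens p q).aestronglyMeasurable 1
      (Eventually.of_forall fun x => (ν.norm_dens p q x).le)
  have h0 := hint.ae_eq_zero_of_forall_setIntegral_eq_zero (fun s hs _ => by
    rw [Measure.restrict_restrict hs]
    exact hvan p q _ (fun y hy => hy.2.1) (hs.inter hVW))
  have hF : ∀ᵐ y ∂((ν.ρ p q).restrict (V ∩ W)), False := by
    filter_upwards [h0] with y hy
    have := ν.norm_dens p q y
    rw [hy] at this
    simp at this
  rw [ae_iff] at hF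
  simpa using hF

/-- The regularizer `t / (1 + n² t²)`. -/
def thetaFn (n : ℕ) (t : ℝ) : ℝ := t / (1 + (n : ℝ) ^ 2 * t ^ 2)

/-- The derivative of `thetaFn n`. -/
def thetaDer (n : ℕ) (t : ℝ) : ℝ := (1 - (n : ℝ) ^ 2 * t ^ 2) / (1 + (n : ℝ) ^ 2 * t ^ 2) ^ 2

theorem theta_den_pos (n : ℕ) (t : ℝ) : 0 < 1 + (n : ℝ) ^ 2 * t ^ 2 := by positivity

theorem theta_contDiff (n : ℕ) : ContDiff ℝ (⊤ : ℕ∞) (thetaFn n) := by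
  unfold thetaFn
  exact contDiff_id.div (by fun_prop) fun t => (theta_den_pos n t).ne'

theorem theta_hasDerivAt (n : ℕ) (t : ℝ) : HasDerivAt (thetaFn n) (thetaDer n t) t := by
  have h1 : HasDerivAt (fun t : ℝ => 1 + (n : ℝ) ^ 2 * t ^ 2) ((n : ℝ) ^ 2 * (2 * t)) t := by
    have := ((hasDerivAt_pow 2 t).const_mul ((n : ℝ) ^ 2)).const_add 1
    simpa using this
  have := (hasDerivAt_id t).div h1 (theta_den_pos n t).ne'
  refine this.congr_deriv ?_
  unfold thetaDer
  congr 1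
  simp only [id]
  ring

theorem theta_abs_le (n : ℕ) (t : ℝ) : |thetaFn n t| ≤ |t| := by
  unfold thetaFn
  rw [abs_div, abs_of_pos (theta_den_pos n t)]
  exact div_le_self (abs_nonneg _) (by nlinarith [sq_nonneg ((n : ℝ) * t)])

theorem thetaDer_abs_le (n : ℕ) (t : ℝ) : |thetaDer n t| ≤ 1 := by
  unfold thetaDer
  have h := theta_den_pos n t
  have h2 : 0 ≤ (n : ℝ) ^ 2 * t ^ 2 := by positivity
  rw [abs_div, abs_of_pos (pow_pos h 2), div_le_one (pow_pos h 2), abs_le]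
  constructor <;> nlinarith

open Filter in
theorem theta_den_tendsto {t : ℝ} (ht : t ≠ 0) :
    Tendsto (fun n : ℕ => 1 + (n : ℝ) ^ 2 * t ^ 2) atTop atTop := by
  refine tendsto_atTop_add_const_left _ _ ?_
  refine Tendsto.atTop_mul_const (by positivity) ?_
  exact (tendsto_pow_atTop two_ne_zero).comp tendsto_natCast_atTop_atTop

open Filter in
theorem theta_tendsto (t : ℝ) : Tendsto (fun n => thetaFn n t) atTop (𝓝 0) := by
  by_cases ht : t = 0
  · simp [thetaFn, ht]
  · exact (tendsto_const_nhds (x := t)).div_atTop (theta_den_tendsto ht)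

open Filter in
theorem thetaDer_tendsto (t : ℝ) :
    Tendsto (fun n => thetaDer n t) atTop (𝓝 (if t = 0 then 1 else 0)) := by
  by_cases ht : t = 0
  · simp [thetaDer, ht]
  · rw [if_neg ht]
    have h1 := (tendsto_const_nhds (x := (1 : ℝ))).div_atTop (theta_den_tendsto ht)
    have h2 : Tendsto (fun n : ℕ => 2 * (1 / (1 + (n : ℝ) ^ 2 * t ^ 2)) ^ 2
      - 1 / (1 + (n : ℝ) ^ 2 * t ^ 2)) atTop (𝓝 (2 * 0 ^ 2 - 0)) :=
      ((h1.pow 2).const_mul 2).sub h1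
    simp only [ne_eq, OfNat.ofNat_ne_zero, not_false_eq_true, zero_pow, mul_zero, sub_zero] at h2
    refine h2.congr fun n => ?_
    have := (theta_den_pos n t).ne'
    unfold thetaDer
    field_simp
    ring

/-- Step 2 of the proof of Lemma 3.5: for the vector field
`H = ∂_{x₁}`, if `∂_{x₁}μ + bμ + μc = ν` distributionally on the open set `U`,
`γ` is smooth with `∂_{x₁}γ ≥ c₀ > 0` on `U`, `Σ = {γ = 0}`, and `supp ν ⊆ Σ`,
then `1_Σ μ = 0`. -/
theorem vanishing_on_graph
    {D N : ℕ} (hD : 0 < D) (U : Set (Fin D → ℝ)) (hU : IsOpen U)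
    (b c : (Fin D → ℝ) → Fin N → Fin N → ℂ)
    (hb : ContDiffOn ℝ (⊤ : ℕ∞) b U) (hc : ContDiffOn ℝ (⊤ : ℕ∞) c U)
    (μ ν : MatRadonMeasure D N U)
    (heq : ∀ φ : (Fin D → ℝ) → Fin N → Fin N → ℂ,
      ContDiff ℝ (⊤ : ℕ∞) φ → HasCompactSupport φ → tsupport φ ⊆ U →
      - μ.trInt (fun x q p => fderiv ℝ (fun y => φ y q p) x (Pi.single (⟨0, hD⟩ : Fin D) 1))
        + μ.trInt (fun x q p => ∑ r, φ x q r * b x r p)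
        + μ.trInt (fun x q p => ∑ r, c x q r * φ x r p)
        = ν.trInt φ)
    (γ : (Fin D → ℝ) → ℝ) (hγ : ContDiffOn ℝ (⊤ : ℕ∞) γ U)
    (c₀ : ℝ) (hc₀ : 0 < c₀)
    (hγ' : ∀ x ∈ U, c₀ ≤ fderiv ℝ γ x (Pi.single (⟨0, hD⟩ : Fin D) 1))
    (S : Set (Fin D → ℝ)) (hSdef : S = {x | x ∈ U ∧ γ x = 0})
    (hsupp : ν.support ⊆ S) :
    μ.VanishesOn S := by
  classical
  set e : Fin D → ℝ := Pi.single (⟨0, hD⟩ : Fin D) 1 with he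
  have hSU : S ⊆ U := by rw [hSdef]; exact fun x hx => hx.1
  have hSγ : ∀ x ∈ U, (x ∈ S ↔ γ x = 0) := by
    intro x hx; rw [hSdef]; exact ⟨fun h => h.2, fun h => ⟨hx, h⟩⟩
  have hγc : ContinuousOn γ U := hγ.continuousOn
  have hγat : ∀ x ∈ U, ContDiffAt ℝ (⊤ : ℕ∞) γ x := fun x hx => hγ.contDiffAt (hU.mem_nhds hx)
  have hγd : ∀ x ∈ U, HasFDerivAt γ (fderiv ℝ γ x) x := fun x hx =>
    ((hγat x hx).differentiableAt (by simp)).hasFDerivAt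
  have hdγc : ContinuousOn (fun x => fderiv ℝ γ x e) U :=
    (hγ.continuousOn_fderiv_of_isOpen hU (by simp)).clm_apply continuousOn_const
  have hSm : MeasurableSet S := by
    have h1 : IsOpen (U ∩ γ ⁻¹' {0}ᶜ) := hγc.isOpen_inter_preimage hU isOpen_compl_singleton
    have : S = U \ (U ∩ γ ⁻¹' {0}ᶜ) := by
      ext x
      rw [hSdef]
      simp only [Set.mem_ofPred_eq, Set.mem_sdiff, Set.mem_inter_iff, Set.mem_preimage,
        Set.mem_compl_iff, Set.mem_singleton_iff]
      tauto
    rw [this]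
    exact hU.measurableSet.diff h1.measurableSet
  -- the limiting identity
  have key : ∀ p q, ∀ g : (Fin D → ℝ) → ℝ, ContDiff ℝ (⊤ : ℕ∞) g → HasCompactSupport g →
      tsupport g ⊆ U →
      ∫ x, g x • (S.indicator (fun x => (fderiv ℝ γ x e : ℂ) * μ.dens p q x) x) ∂(μ.ρ p q) = 0 := by
    intro p q g hg hgc hgU
    set K := tsupport g with hKdef
    have hK : IsCompact K := hgc
    let f : ℕ → (Fin D → ℝ) → ℝ := fun n x => g x * thetaFn n (γ x)
    let M : Fin N → Fin N → ℂ := fun i j => if i = q ∧ j = p then 1 else 0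
    have hg0 : ∀ x ∉ K, g x = 0 := fun x hx => image_eq_zero_of_notMem_tsupport hx
    have hf0 : ∀ n, ∀ x ∉ K, f n x = 0 := fun n x hx => by simp [f, hg0 x hx]
    have hfK : ∀ n, tsupport (f n) ⊆ K := fun n =>
      closure_minimal (fun x hx => by
        by_contra h
        exact hx (hf0 n x h)) (isClosed_tsupport g)
    have hfs : ∀ n, ContDiff ℝ (⊤ : ℕ∞) (f n) := fun n =>
      contDiff_iff_contDiffAt.2 fun x => by
        by_cases hx : x ∈ K
        · exact hg.contDiffAt.mul ((theta_contDiff n).contDiffAt.comp x (hγat x (hgU hx)))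
        · have h0 : f n =ᶠ[𝓝 x] fun _ => 0 := by
            filter_upwards [(isClosed_tsupport g).isOpen_compl.mem_nhds hx] with y hy
            exact hf0 n y hy
          exact contDiffAt_const.congr_of_eventuallyEq h0
    have hfd : ∀ n, ∀ x ∈ U, fderiv ℝ (f n) x e
        = g x * (thetaDer n (γ x) * fderiv ℝ γ x e) + thetaFn n (γ x) * fderiv ℝ g x e := by
      intro n x hx
      have h1 : HasFDerivAt (fun y => thetaFn n (γ y)) (thetaDer n (γ x) • fderiv ℝ γ x) x :=
        (theta_hasDerivAt n (γ x)).comp_hasFDerivAt x (hγd x hx)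
      have h2 : HasFDerivAt g (fderiv ℝ g x) x :=
        (hg.differentiable (by simp) x).hasFDerivAt
      have h3 := (h2.mul h1).fderiv
      have h4 : fderiv ℝ (f n) x = _ := h3
      rw [h4]
      simp
    have hfd0 : ∀ n, ∀ x ∉ K, fderiv ℝ (f n) x e = 0 := by
      intro n x hx
      rw [fderiv_of_notMem_tsupport (𝕜 := ℝ) (fun h => hx (hfK n h))]
      simp
    have hgγ : ContinuousOn (fun x => |g x| * |γ x|) U := (hg.continuous.continuousOn.abs).mul hγc.abs
    have hfle : ∀ n x, |f n x| ≤ |g x| * |γ x| := fun n x => by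
      simp only [f, abs_mul]
      exact mul_le_mul_of_nonneg_left (theta_abs_le n _) (abs_nonneg _)
    have hflim : ∀ x, Filter.Tendsto (fun n => f n x) Filter.atTop (𝓝 0) := fun x => by
      simpa using (theta_tendsto (γ x)).const_mul (g x)
    have hbij : ∀ i j, ContinuousOn (fun x => b x i j) U := fun i j =>
      continuousOn_pi.1 (continuousOn_pi.1 hb.continuousOn i) j
    have hcij : ∀ i j, ContinuousOn (fun x => c x i j) U := fun i j =>
      continuousOn_pi.1 (continuousOn_pi.1 hc.continuousOn i) j
    have T1 := mrm_dct hU μ hK hgU (fun n x => fderiv ℝ (f n) x e)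
      (fun x => S.indicator (fun x => g x * fderiv ℝ γ x e) x) (fun _ => M)
      (fun i j => continuousOn_const)
      (fun n => (((hfs n).continuous_fderiv (by simp)).clm_apply continuous_const).continuousOn)
      (fun x => |g x| * |fderiv ℝ γ x e| + |γ x| * |fderiv ℝ g x e|)
      ((hg.continuous.continuousOn.abs.mul hdγc.abs).add (hγc.abs.mul
        (((hg.continuous_fderiv (by simp)).clm_apply continuous_const).continuousOn.abs)))
      (by
        intro n x hx
        simp only [hfd n x (hgU hx)]
        refine (abs_add_le _ _).trans (add_le_add ?_ ?_)
        · rw [abs_mul, abs_mul]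
          refine mul_le_mul_of_nonneg_left ?_ (abs_nonneg _)
          exact mul_le_of_le_one_left (abs_nonneg _) (thetaDer_abs_le n _)
        · rw [abs_mul]
          exact mul_le_mul_of_nonneg_right (theta_abs_le n _) (abs_nonneg _))
      hfd0
      (by
        intro x hx
        simp [Set.indicator, hg0 x hx])
      (by
        intro x hx
        have h1 := (((thetaDer_tendsto (γ x)).mul_const (fderiv ℝ γ x e)).const_mul (g x)).add
          ((theta_tendsto (γ x)).mul_const (fderiv ℝ g x e))
        simp only [hfd _ x (hgU hx)]
        convert h1 using 2
        by_cases h : γ x = 0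
        · simp [Set.indicator, hSγ x (hgU hx), h]
        · simp [Set.indicator, hSγ x (hgU hx), h])
    have T2 := mrm_dct hU μ hK hgU f (fun _ => 0) (fun x i j => ∑ r, M i r * b x r j)
      (fun i j => continuousOn_finsetSum _ fun r _ => continuousOn_const.mul (hbij r j))
      (fun n => (hfs n).continuous.continuousOn) _ hgγ (fun n x _ => hfle n x) hf0
      (fun _ _ => rfl) (fun x _ => hflim x)
    have T3 := mrm_dct hU μ hK hgU f (fun _ => 0) (fun x i j => ∑ r, c x i r * M r j)
      (fun i j => continuousOn_finsetSum _ fun r _ => (hcij i r).mul continuousOn_const)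
      (fun n => (hfs n).continuous.continuousOn) _ hgγ (fun n x _ => hfle n x) hf0
      (fun _ _ => rfl) (fun x _ => hflim x)
    have hEq : ∀ n, - μ.trInt (fun x i j => ((fderiv ℝ (f n) x e : ℝ) : ℂ) * M i j)
        + μ.trInt (fun x i j => (f n x : ℂ) * ∑ r, M i r * b x r j)
        + μ.trInt (fun x i j => (f n x : ℂ) * ∑ r, c x i r * M r j) = 0 := by
      intro n
      have hsub : tsupport (fun x i j => (f n x : ℂ) * M i j) ⊆ K :=
        closure_minimal (fun x hx => by
          by_contra h
          apply hx
          funext i j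
          simp [hf0 n x h]) (isClosed_tsupport g)
      have h := heq (fun x i j => (f n x : ℂ) * M i j)
        (contDiff_pi.2 fun i => contDiff_pi.2 fun j =>
          (Complex.ofRealCLM.contDiff.comp (hfs n)).mul contDiff_const)
        (hK.of_isClosed_subset (isClosed_tsupport _) hsub) (hsub.trans hgU)
      have hν : ν.trInt (fun x i j => (f n x : ℂ) * M i j) = 0 := by
        unfold MatRadonMeasure.trInt
        refine Finset.sum_eq_zero fun i _ => Finset.sum_eq_zero fun j _ => ?_
        refine integral_eq_zero_of_ae ?_
        have a1 : ∀ᵐ x ∂(ν.ρ i j), x ∉ U \ S :=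
          measure_eq_zero_iff_ae_notMem.1 (mrm_null_off_support ν S hsupp i j)
        filter_upwards [a1] with x hx
        have : f n x = 0 := by
          by_cases hxU : x ∈ U
          · have hxS : x ∈ S := by
              by_contra h'
              exact hx ⟨hxU, h'⟩
            have := (hSγ x hxU).1 hxS
            simp [f, this, thetaFn]
          · exact hf0 n x fun h' => hxU (hgU h')
        simp [this]
      rw [hν] at h
      rw [← h]
      have e1 : ∀ x i j, fderiv ℝ (fun y => (f n y : ℂ) * M i j) x e
          = ((fderiv ℝ (f n) x e : ℝ) : ℂ) * M i j := by
        intro x i j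
        have h2 : HasFDerivAt (f n) (fderiv ℝ (f n) x) x :=
          ((hfs n).differentiable (by simp) x).hasFDerivAt
        have h3 : HasFDerivAt (fun y => (f n y : ℂ))
            (Complex.ofRealCLM.comp (fderiv ℝ (f n) x)) x :=
          Complex.ofRealCLM.hasFDerivAt.comp x h2
        rw [(h3.mul_const (M i j)).fderiv]
        simp [mul_comm]
      simp only [e1, Finset.mul_sum]
      congr 2
      · congr 1
        funext x i j
        exact Finset.sum_congr rfl fun r _ => by ring
      · funext x i j
        exact Finset.sum_congr rfl fun r _ => by ring
    have T := (T1.neg.add T2).add T3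
    simp only [hEq] at T
    have hlim := tendsto_nhds_unique T tendsto_const_nhds
    have z1 : ∀ m : (Fin D → ℝ) → Fin N → Fin N → ℂ,
        μ.trInt (fun x i j => ((0 : ℝ) : ℂ) * m x i j) = 0 := by
      intro m
      simp [MatRadonMeasure.trInt]
    rw [z1, z1, add_zero, add_zero, neg_eq_zero] at hlim
    unfold MatRadonMeasure.trInt at hlim
    rw [Finset.sum_eq_single p, Finset.sum_eq_single q] at hlim
    · rw [← hlim]
      refine integral_congr_ae (Filter.Eventually.of_forall fun x => ?_)
      by_cases hx : x ∈ S
      · simp [hx, M, mul_assoc]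
      · simp [hx]
    · intro j _ hj
      simp [M, hj]
    · simp
    · intro i _ hi
      refine Finset.sum_eq_zero fun j _ => ?_
      simp [M, hi]
    · simp
  intro p q B hBS hBm
  have hloc : LocallyIntegrableOn (S.indicator (fun x => (fderiv ℝ γ x e : ℂ) * μ.dens p q x)) U
      (μ.ρ p q) := by
    rw [locallyIntegrableOn_iff hU.isLocallyClosed]
    intro K hKU hK
    obtain ⟨C, hC⟩ := hK.exists_bound_of_continuousOn (hdγc.mono hKU)
    have hfin := mrm_compact_lt_top μ p q hK hKU
    refine Measure.integrableOn_of_bounded (M := C) hfin.ne ?_ ?_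
    · refine Measurable.aestronglyMeasurable (Measurable.indicator ?_ hSm)
      exact (Complex.measurable_ofReal.comp (measurable_fderiv_apply_const ℝ γ e)).mul
        (μ.meas_dens p q)
    · filter_upwards [ae_restrict_mem hK.measurableSet] with x hx
      refine (norm_indicator_le_norm_self _ _).trans ?_
      rw [norm_mul, μ.norm_dens, mul_one, Complex.norm_real]
      exact hC x hx
  have hae := hU.ae_eq_zero_of_integral_contDiff_smul_eq_zero hloc
    (fun g hg hgc hgU => key p q g hg hgc hgU)
  have hS0 : μ.ρ p q S = 0 := by
    rw [measure_eq_zero_iff_ae_notMem]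
    filter_upwards [hae] with x hx hxS
    have h1 := hx (hSU hxS)
    rw [Set.indicator_of_mem hxS] at h1
    have h2 := congrArg norm h1
    rw [norm_mul, μ.norm_dens, mul_one, Complex.norm_real, norm_zero, norm_eq_zero] at h2
    have := hγ' x (hSU hxS)
    linarith
  unfold MatRadonMeasure.entry
  rw [Measure.restrict_eq_zero.2 (measure_mono_null hBS hS0)]
  simp
end
end

section
/- Let Ω ⊆ ℝ^D be open, H = a·∇ a C^∞ vector field on Ω with a(x) ≠ 0 for all x ∈ Ω, and Σ a C^∞ hypersurface of Ω closed in Ω. Assume Σ(∞;H) ⊆ ⋃_{j∈J} Z_j, where J is finite or countable and each Z_j is a C^∞ hypersurface of Ω having only finite order contact with H, i.e. for every point x̃ ∈ Z_j there is an integer k ≥ 0 with x̃ ∈ Z_j(k;H). Then there exists an ordinal α such that F(α;H;Σ) = ∅. -/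
noncomputable section
open Topology MeasureTheory


open Filter Set

/-- Comparison `|f| ≤ C |g|` near a point of a common zero set where `dg ≠ 0`. -/
lemma aux_bound {D : ℕ} {W : Set (Fin D → ℝ)} (hW : IsOpen W) {x : Fin D → ℝ} (hx : x ∈ W)
    {f g : (Fin D → ℝ) → ℝ} (hg : ContDiffAt ℝ 1 g x) (hf : ContDiffAt ℝ 1 f x)
    (hd : fderiv ℝ g x ≠ 0) (hgx : g x = 0) (hgc : ContinuousOn g W)
    (hz : ∀ y ∈ W, g y = 0 → f y = 0) :
    ∃ C : ℝ, 0 ≤ C ∧ ∀ᶠ y in 𝓝 x, |f y| ≤ C * |g y| := by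
  obtain ⟨w, hw⟩ : ∃ w, fderiv ℝ g x w ≠ 0 := by
    by_contra! h
    exact hd (ContinuousLinearMap.ext h)
  obtain ⟨v, hv⟩ : ∃ v, fderiv ℝ g x v = 1 :=
    ⟨(fderiv ℝ g x w)⁻¹ • w, by simp [hw]⟩
  have hv0 : 0 < ‖v‖ := by
    rw [norm_pos_iff]; rintro rfl; simp at hv
  have hs := hg.hasStrictFDerivAt (by norm_num)
  obtain ⟨K, s, hs', hl⟩ := hf.exists_lipschitzOnWith
  have h1 := hs.isLittleO.def (c := (2 * ‖v‖)⁻¹) (by positivity)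
  rw [nhds_prod_eq, eventually_prod_self_iff'] at h1
  obtain ⟨T, hT, hT'⟩ := h1
  obtain ⟨R, hR, hball⟩ := Metric.mem_nhds_iff.1 (inter_mem (inter_mem hT hs') (hW.mem_nhds hx))
  refine ⟨K * (2 * ‖v‖), by positivity, ?_⟩
  have hgc0 : Tendsto (fun y => |g y|) (𝓝 x) (𝓝 0) := by
    have := hg.continuousAt.abs
    unfold ContinuousAt at this
    simpa [hgx] using this
  have e1 : ∀ᶠ y in 𝓝 x, |g y| < R / 4 / ‖v‖ := hgc0.eventually (gt_mem_nhds (by positivity))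
  filter_upwards [e1, Metric.ball_mem_nhds x (half_pos hR)] with y hy hyR
  rw [lt_div_iff₀ hv0] at hy
  set s0 := 2 * |g y| with hs0
  have hs00 : 0 ≤ s0 := by positivity
  have hmem : ∀ t, |t| ≤ s0 → y + t • v ∈ Metric.ball x R := by
    intro t ht
    rw [Metric.mem_ball, dist_eq_norm] at hyR ⊢
    have : ‖y + t • v - x‖ ≤ ‖y - x‖ + |t| * ‖v‖ := by
      have : y + t • v - x = (y - x) + t • v := by abel
      rw [this]
      refine (norm_add_le _ _).trans ?_
      rw [norm_smul, Real.norm_eq_abs]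
    nlinarith
  have hyb : y ∈ Metric.ball x R := by simpa using hmem 0 (by simpa using hs00)
  have key : ∀ t, |t| ≤ s0 → |g (y + t • v) - g y - t| ≤ |t| / 2 := by
    intro t ht
    have := hT' _ (hball (hmem t ht)).1.1 _ (hball hyb).1.1
    simp only [add_sub_cancel_left, map_smul, hv, smul_eq_mul, mul_one, norm_smul,
      Real.norm_eq_abs] at this
    refine this.trans (le_of_eq ?_)
    field_simp
  have hcont : ContinuousOn (fun t : ℝ => g (y + t • v)) (Icc (-s0) s0) := by
    refine hgc.comp (by fun_prop) fun t ht => (hball (hmem t (abs_le.2 ht))).2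
  have k1 := abs_le.1 (key s0 (by rw [abs_of_nonneg hs00]))
  have k2 := abs_le.1 (key (-s0) (by rw [abs_neg, abs_of_nonneg hs00]))
  rw [abs_neg, abs_of_nonneg hs00] at k2
  rw [abs_of_nonneg hs00] at k1
  have a1 := le_abs_self (g y)
  have a2 := neg_abs_le (g y)
  obtain ⟨t, ht, ht0⟩ := intermediate_value_Icc (by linarith) hcont
    (show (0 : ℝ) ∈ Icc _ _ from ⟨by linarith [k2.2], by linarith [k1.1]⟩)
  have htb := hball (hmem t (abs_le.2 ht))
  have hf0 := hz _ htb.2 ht0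
  have := hl.dist_le_mul _ (hball hyb).1.2 _ htb.1.2
  rw [hf0, Real.dist_eq, sub_zero, dist_eq_norm] at this
  refine this.trans ?_
  have e : ‖y - (y + t • v)‖ = |t| * ‖v‖ := by
    rw [sub_add_cancel_left, norm_neg, norm_smul, Real.norm_eq_abs]
  rw [e]
  have : |t| ≤ s0 := abs_le.2 ht
  calc (K : ℝ) * (|t| * ‖v‖) ≤ K * (s0 * ‖v‖) := by gcongr
    _ = _ := by rw [hs0]; ring

/-- A chain of successive derivatives, all vanishing at `0`, is flat at `0`. -/
lemma aux_flat {δ : ℝ} (hδ : 0 < δ) (G : ℕ → ℝ → ℝ)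
    (hG : ∀ i, ∀ t ∈ Ioo (-δ) δ, HasDerivAt (G i) (G (i + 1) t) t)
    (h0 : ∀ i, G i 0 = 0) (m : ℕ) :
    ∀ i, ∃ C : ℝ, ∃ ε > 0, ∀ t ∈ Icc 0 ε, |G i t| ≤ C * t ^ m := by
  induction m with
  | zero =>
    intro i
    have hc : ContinuousAt (G i) 0 := (hG i 0 ⟨by linarith, hδ⟩).continuousAt
    have := hc.abs
    unfold ContinuousAt at this
    simp only [h0, abs_zero] at this
    obtain ⟨ε, hε, h⟩ := Metric.eventually_nhds_iff.1 (this.eventually (gt_mem_nhds one_pos))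
    refine ⟨1, ε / 2, by positivity, fun t ht => ?_⟩
    have := h (y := t) (by rw [Real.dist_eq, sub_zero, abs_of_nonneg ht.1]; linarith [ht.2])
    simpa using this.le
  | succ m ih =>
    intro i
    obtain ⟨C, ε, hε, h⟩ := ih (i + 1)
    refine ⟨C, min ε (δ / 2), by positivity, fun t ht => ?_⟩
    have htε : t ≤ ε := ht.2.trans (min_le_left _ _)
    have htδ : t ≤ δ / 2 := ht.2.trans (min_le_right _ _)
    have ht0 := ht.1
    have hC : 0 ≤ C := by
      have := (abs_nonneg _).trans (h ε ⟨hε.le, le_rfl⟩)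
      exact nonneg_of_mul_nonneg_left this (by positivity)
    have := Convex.norm_image_sub_le_of_norm_hasDerivWithin_le (f := G i) (f' := G (i + 1))
      (s := Icc 0 t) (C := C * t ^ m) (x := 0) (y := t)
      (fun s hs => (hG i s ⟨by linarith [hs.1], by linarith [hs.2]⟩).hasDerivWithinAt)
      (fun s hs => by
        refine (h s ⟨hs.1, hs.2.trans htε⟩).trans ?_
        have := pow_le_pow_left₀ hs.1 hs.2 m
        gcongr) (convex_Icc _ _) ⟨le_rfl, ht0⟩ ⟨ht0, le_rfl⟩
    rw [h0, sub_zero, sub_zero, Real.norm_eq_abs, Real.norm_eq_abs, abs_of_nonneg ht0] at this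
    rw [pow_succ, ← mul_assoc]; exact this

/-- Lower bound for a chain of derivatives whose first nonzero value at `0` is the `n`-th one. -/
lemma aux_lower {δ : ℝ} (hδ : 0 < δ) (n : ℕ) : ∀ (G : ℕ → ℝ → ℝ)
    (_ : ∀ i, ∀ t ∈ Ioo (-δ) δ, HasDerivAt (G i) (G (i + 1) t) t)
    (_ : ∀ i < n, G i 0 = 0) (_ : 0 < G n 0),
    ∃ c > 0, ∃ ε > 0, ∀ t ∈ Icc 0 ε, c * t ^ n ≤ G 0 t := by
  induction n with
  | zero =>
    intro G hG _ hn
    have hc : ContinuousAt (G 0) 0 := (hG 0 0 ⟨by linarith, hδ⟩).continuousAt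
    obtain ⟨ε, hε, h⟩ := Metric.eventually_nhds_iff.1
      (hc.eventually (lt_mem_nhds (half_lt_self hn)))
    refine ⟨G 0 0 / 2, by positivity, ε / 2, by positivity, fun t ht => ?_⟩
    have := h (y := t) (by rw [Real.dist_eq, sub_zero, abs_of_nonneg ht.1]; linarith [ht.2])
    simpa using this.le
  | succ n ih =>
    intro G hG h0 hn
    obtain ⟨c, hc, ε, hε, h⟩ := ih (fun i => G (i + 1)) (fun i => hG (i + 1))
      (fun i hi => h0 (i + 1) (by omega)) hn
    refine ⟨c / (n + 1), by positivity, min ε (δ / 2), by positivity, fun t ht => ?_⟩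
    have htε : t ≤ ε := ht.2.trans (min_le_left _ _)
    have htδ : t ≤ δ / 2 := ht.2.trans (min_le_right _ _)
    have ht0 := ht.1
    have hd : ∀ s ∈ Icc 0 t, HasDerivAt (fun s => G 0 s - c / (n + 1) * s ^ (n + 1))
        (G 1 s - c * s ^ n) s := by
      intro s hs
      have h1 := hG 0 s ⟨by linarith [hs.1], by linarith [hs.2]⟩
      have h2 := (hasDerivAt_pow (n + 1) s).const_mul (c / (n + 1))
      refine (h1.sub h2).congr_deriv ?_
      have hn1 : (n : ℝ) + 1 ≠ 0 := by positivity
      have e : c / (n + 1) * (((n + 1 : ℕ) : ℝ) * s ^ (n + 1 - 1)) = c * s ^ n := by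
        rw [Nat.add_sub_cancel]
        push_cast
        field_simp
      rw [e]
    have hm : MonotoneOn (fun s => G 0 s - c / (n + 1) * s ^ (n + 1)) (Icc 0 t) := by
      refine monotoneOn_of_deriv_nonneg (convex_Icc _ _)
        (fun s hs => (hd s hs).continuousAt.continuousWithinAt)
        (fun s hs => (hd s (interior_subset hs)).differentiableAt.differentiableWithinAt) ?_
      intro s hs
      have hs := interior_subset hs
      rw [(hd s hs).deriv]
      have := h s ⟨hs.1, hs.2.trans htε⟩
      simp only [zero_add] at this
      linarith
    have := hm ⟨le_rfl, ht0⟩ ⟨ht0, le_rfl⟩ ht0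
    simp only [h0 0 (by omega)] at this
    simp at this
    linarith

lemma aux_contDiffOn_iter {D : ℕ} {W : Set (Fin D → ℝ)} (hW : IsOpen W)
    {a : (Fin D → ℝ) → (Fin D → ℝ)} (ha : ContDiffOn ℝ (⊤ : ℕ∞) a W)
    {f : (Fin D → ℝ) → ℝ} (hf : ContDiffOn ℝ (⊤ : ℕ∞) f W) (k : ℕ) :
    ContDiffOn ℝ (⊤ : ℕ∞) (vfIter a k f) W := by
  induction k with
  | zero => exact hf
  | succ k ih => exact (ih.fderiv_of_isOpen hW (by simp)).clm_apply ha

/-- Infinite order contact does not depend on the defining function. -/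
lemma aux_indep {D : ℕ} {W : Set (Fin D → ℝ)} (hW : IsOpen W) {x : Fin D → ℝ} (hx : x ∈ W)
    {a : (Fin D → ℝ) → (Fin D → ℝ)} (ha : ContDiffOn ℝ (⊤ : ℕ∞) a W)
    {f g : (Fin D → ℝ) → ℝ} (hg : ContDiffOn ℝ (⊤ : ℕ∞) g W) (hf : ContDiffOn ℝ (⊤ : ℕ∞) f W)
    (hd : fderiv ℝ g x ≠ 0) (hz : ∀ y ∈ W, g y = 0 → f y = 0)
    (h0 : ∀ i, vfIter a i g x = 0) : ∀ i, vfIter a i f x = 0 := by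
  have hWx := hW.mem_nhds hx
  have h1 : (1 : WithTop ℕ∞) ≤ ((⊤ : ℕ∞) : WithTop ℕ∞) := by exact_mod_cast le_top
  obtain ⟨C, hC, hb⟩ := aux_bound hW hx ((hg.contDiffAt hWx).of_le h1)
    ((hf.contDiffAt hWx).of_le h1) hd (h0 0) hg.continuousOn hz
  obtain ⟨c, hc0, ε, hε, hc⟩ :=
    ((ha.contDiffAt hWx).of_le h1).exists_forall_mem_closedBall_exists_eq_forall_mem_Ioo_hasDerivAt₀ 0
  have hcc : ContinuousAt c 0 := (hc 0 ⟨by linarith, by linarith⟩).continuousAt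
  unfold ContinuousAt at hcc
  rw [hc0] at hcc
  obtain ⟨δ', hδ', hδ''⟩ := Metric.eventually_nhds_iff.1 (hcc.eventually (hb.and hWx))
  set δ := min ε δ' with hδdef
  have hδ : 0 < δ := lt_min hε hδ'
  have hmem : ∀ t ∈ Ioo (-δ) δ, |f (c t)| ≤ C * |g (c t)| ∧ c t ∈ W := by
    intro t ht
    refine hδ'' ?_
    rw [Real.dist_eq, sub_zero]
    exact (abs_lt.2 ht).trans_le (min_le_right _ _)
  have hder : ∀ u : (Fin D → ℝ) → ℝ, ContDiffOn ℝ (⊤ : ℕ∞) u W → ∀ i, ∀ t ∈ Ioo (-δ) δ,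
      HasDerivAt (fun t => vfIter a i u (c t)) (vfIter a (i + 1) u (c t)) t := by
    intro u hu i t ht
    have hd1 : HasFDerivAt (vfIter a i u) (fderiv ℝ (vfIter a i u) (c t)) (c t) :=
      (((aux_contDiffOn_iter hW ha hu i).contDiffAt (hW.mem_nhds (hmem t ht).2)).differentiableAt
        (by simp)).hasFDerivAt
    have hle : δ ≤ ε := min_le_left _ _
    exact hd1.comp_hasDerivAt t (hc t ⟨by linarith [ht.1], by linarith [ht.2]⟩)
  by_contra! hne
  classical
  have hfn := Nat.find_spec hne
  set n := Nat.find hne with hn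
  have hlt : ∀ i < n, vfIter a i f x = 0 := fun i hi => by
    simpa using Nat.find_min hne hi
  obtain ⟨C', ε₁, hε₁, hfl⟩ := aux_flat hδ (fun i t => vfIter a i g (c t)) (hder g hg)
    (fun i => by simp only [hc0]; exact h0 i) (n + 1) 0
  obtain ⟨c', hc', ε₂, hε₂, hlow⟩ : ∃ c' > 0, ∃ ε > 0, ∀ t ∈ Icc 0 ε, c' * t ^ n ≤ |f (c t)| := by
    rcases lt_or_gt_of_ne hfn with hneg | hpos
    · obtain ⟨c', hc', ε₂, hε₂, h⟩ := aux_lower hδ n (fun i t => - vfIter a i f (c t))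
        (fun i t ht => (hder f hf i t ht).neg)
        (fun i hi => by simp only [hc0, hlt i hi, neg_zero]) (by simpa only [hc0, neg_pos] using hneg)
      exact ⟨c', hc', ε₂, hε₂, fun t ht => (h t ht).trans (neg_le_abs _)⟩
    · obtain ⟨c', hc', ε₂, hε₂, h⟩ := aux_lower hδ n (fun i t => vfIter a i f (c t))
        (hder f hf)
        (fun i hi => by simp only [hc0, hlt i hi]) (by simpa only [hc0] using hpos)
      exact ⟨c', hc', ε₂, hε₂, fun t ht => (h t ht).trans (le_abs_self _)⟩
  have key : ∀ t, 0 < t → t ≤ ε₁ → t ≤ ε₂ → t < δ → c' ≤ C * C' * t := by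
    intro t ht h1 h2 h3
    have e1 := hlow t ⟨ht.le, h2⟩
    have e2 := (hmem t ⟨by linarith, h3⟩).1
    have e3 : |g (c t)| ≤ C' * t ^ (n + 1) := hfl t ⟨ht.le, h1⟩
    have e4 : c' * t ^ n ≤ C * C' * t * t ^ n := by
      calc _ ≤ _ := e1
        _ ≤ _ := e2
        _ ≤ C * (C' * t ^ (n + 1)) := by gcongr
        _ = _ := by ring
    exact le_of_mul_le_mul_right e4 (by positivity)
  have hlim : Tendsto (fun t : ℝ => C * C' * t) (𝓝[>] 0) (𝓝 0) := by
    have : Tendsto (fun t : ℝ => C * C' * t) (𝓝 0) (𝓝 (C * C' * 0)) :=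
      (continuous_const.mul continuous_id).tendsto 0
    rw [mul_zero] at this
    exact this.mono_left nhdsWithin_le_nhds
  have hge := ge_of_tendsto hlim (b := c') (by
    have : ∀ᶠ t in 𝓝[>] (0 : ℝ), t ∈ Ioo 0 (min (min ε₁ ε₂) δ) :=
      Ioo_mem_nhdsGT (by positivity)
    filter_upwards [this] with t ht
    have := ht.2
    simp only [lt_min_iff] at this
    exact key t ht.1 this.1.1.le this.1.2.le this.2)
  linarith

lemma aux_contactInf_closed {D : ℕ} {Ω S : Set (Fin D → ℝ)}
    {a : (Fin D → ℝ) → (Fin D → ℝ)} (ha : ContDiffOn ℝ (⊤ : ℕ∞) a Ω)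
    (hS : IsHypersurface Ω S) (hScl : closure S ∩ Ω ⊆ S) :
    closure (contactInf a Ω S) ∩ Ω ⊆ contactInf a Ω S := by
  rintro x ⟨hx, hxΩ⟩
  have hxS : x ∈ S := hScl ⟨closure_mono (fun y hy => hy.1) hx, hxΩ⟩
  obtain ⟨U, γ, hU, hxU⟩ := hS.2 x hxS
  refine ⟨hxS, U, γ, hU, hxU, fun i _ => ?_⟩
  obtain ⟨hUo, hUΩ, hγ, hγd, hγS⟩ := hU
  by_contra hne
  have hci := (aux_contDiffOn_iter hUo (ha.mono hUΩ) hγ i).continuousOn.continuousAt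
    (hUo.mem_nhds hxU)
  have hev : ∀ᶠ y in 𝓝 x, vfIter a i γ y ≠ 0 ∧ y ∈ U :=
    (hci.eventually_ne hne).and (hUo.mem_nhds hxU)
  obtain ⟨y, ⟨hy1, hy2⟩, hyS, V, g, ⟨hVo, hVΩ, hg, hgd, hgS⟩, hyV, hgi⟩ :=
    mem_closure_iff_nhds.1 hx _ hev
  refine hy1 (aux_indep (hUo.inter hVo) ⟨hy2, hyV⟩ (ha.mono (inter_subset_left.trans hUΩ))
    (hg.mono inter_subset_right) (hγ.mono inter_subset_left) (hgd y hyV) ?_ ?_ i)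
  · intro z hz hz0
    have : z ∈ S ∩ V := by rw [hgS]; exact ⟨hz.2, hz0⟩
    have : z ∈ S ∩ U := ⟨this.1, hz.1⟩
    rw [hγS] at this
    exact this.2
  · intro j
    rcases Nat.eq_zero_or_pos j with rfl | hj
    · have : y ∈ S ∩ V := ⟨hyS, hyV⟩
      rw [hgS] at this
      exact this.2
    · exact hgi j hj

/-- The set of points removed at one step of the recursion. -/
def auxRemoved {D : ℕ} (a : (Fin D → ℝ) → (Fin D → ℝ)) (Ω F : Set (Fin D → ℝ)) :
    Set (Fin D → ℝ) :=
  {x | ∃ U Θ, IsOpen U ∧ x ∈ U ∧ U ⊆ Ω ∧ IsHypersurface U Θ ∧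
        F ∩ U ⊆ Θ ∧ ∃ k : ℕ, x ∈ contactSet a U Θ k}

lemma aux_Fset_zero {D : ℕ} (a : (Fin D → ℝ) → (Fin D → ℝ)) (Ω S : Set (Fin D → ℝ)) :
    Fset a Ω S 0 = contactInf a Ω S := Ordinal.limitRecOn_zero ..

lemma aux_Fset_succ {D : ℕ} (a : (Fin D → ℝ) → (Fin D → ℝ)) (Ω S : Set (Fin D → ℝ))
    (α : Ordinal) :
    Fset a Ω S (α + 1) = Fset a Ω S α \ auxRemoved a Ω (Fset a Ω S α) :=
  Ordinal.limitRecOn_add_one ..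

lemma aux_Fset_limit {D : ℕ} (a : (Fin D → ℝ) → (Fin D → ℝ)) (Ω S : Set (Fin D → ℝ))
    (α : Ordinal) (h : Order.IsSuccLimit α) :
    Fset a Ω S α = ⋂ (β) (_ : β < α), Fset a Ω S β :=
  Ordinal.limitRecOn_limit _ _ _ _ h

lemma aux_Fset_anti {D : ℕ} (a : (Fin D → ℝ) → (Fin D → ℝ)) (Ω S : Set (Fin D → ℝ))
    (α : Ordinal) : ∀ β ≤ α, Fset a Ω S α ⊆ Fset a Ω S β := by
  induction α using Ordinal.limitRecOn with
  | zero => intro β hβ; rw [nonpos_iff_eq_zero.1 hβ]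
  | add_one α ih =>
    intro β hβ
    rcases hβ.eq_or_lt with rfl | hlt
    · rfl
    · rw [aux_Fset_succ]
      exact sdiff_subset.trans (ih β (Order.lt_add_one_iff.1 hlt))
  | limit α hα ih =>
    intro β hβ
    rcases hβ.eq_or_lt with rfl | hlt
    · rfl
    · rw [aux_Fset_limit _ _ _ _ hα]
      exact iInter₂_subset β hlt

/-- A point near a removed point and in `F` is removed. -/
lemma aux_removed_open {D : ℕ} {a : (Fin D → ℝ) → (Fin D → ℝ)} {Ω F : Set (Fin D → ℝ)}
    (ha : ContDiffOn ℝ (⊤ : ℕ∞) a Ω) {x : Fin D → ℝ} (hx : x ∈ auxRemoved a Ω F) :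
    ∀ᶠ y in 𝓝 x, y ∈ F → y ∈ auxRemoved a Ω F := by
  obtain ⟨U, Θ, hU, hxU, hUΩ, hΘ, hF, k, hxΘ, V, γ, hV, hxV, -, hk⟩ := hx
  have hV' := hV
  obtain ⟨hVo, hVU, hγ, hγd, hγS⟩ := hV'
  have hci := (aux_contDiffOn_iter hVo (ha.mono (hVU.trans hUΩ)) hγ (k + 1)).continuousOn.continuousAt
    (hVo.mem_nhds hxV)
  filter_upwards [hci.eventually_ne hk, hVo.mem_nhds hxV] with y hy hyV hyF
  have hex : ∃ j, vfIter a (j + 1) γ y ≠ 0 := ⟨k, hy⟩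
  classical
  refine ⟨U, Θ, hU, hVU hyV, hUΩ, hΘ, hF, Nat.find hex, hF ⟨hyF, hVU hyV⟩, V, γ, hV, hyV, ?_,
    Nat.find_spec hex⟩
  intro i hi hik
  have := Nat.find_min hex (m := i - 1) (by omega)
  rw [Nat.sub_add_cancel hi] at this
  simpa using this

lemma aux_Fset_closed {D : ℕ} {Ω S : Set (Fin D → ℝ)}
    {a : (Fin D → ℝ) → (Fin D → ℝ)} (ha : ContDiffOn ℝ (⊤ : ℕ∞) a Ω)
    (hS : IsHypersurface Ω S) (hScl : closure S ∩ Ω ⊆ S) (α : Ordinal) :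
    closure (Fset a Ω S α) ∩ Ω ⊆ Fset a Ω S α := by
  induction α using Ordinal.limitRecOn with
  | zero => rw [aux_Fset_zero]; exact aux_contactInf_closed ha hS hScl
  | add_one α ih =>
    rw [aux_Fset_succ]
    rintro x ⟨hx, hxΩ⟩
    refine ⟨ih ⟨closure_mono sdiff_subset hx, hxΩ⟩, fun hr => ?_⟩
    obtain ⟨y, hy, hyF, hyn⟩ := mem_closure_iff_nhds.1 hx _ (aux_removed_open ha hr)
    exact hyn (hy hyF)
  | limit α hα ih =>
    rw [aux_Fset_limit _ _ _ _ hα]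
    rintro x ⟨hx, hxΩ⟩
    refine mem_iInter₂.2 fun β hβ => ih β hβ ⟨closure_mono (iInter₂_subset β hβ) hx, hxΩ⟩

lemma aux_locallyClosed {D : ℕ} {Ω Z : Set (Fin D → ℝ)} (hZ : IsHypersurface Ω Z) :
    IsLocallyClosed Z := by
  refine ((isLocallyClosed_tfae Z).out 0 3).2 fun x hx => ?_
  obtain ⟨U, γ, ⟨hU, -, hγ, -, hS⟩, hxU⟩ := hZ.2 x hx
  refine ⟨U, hxU, hU, ?_⟩
  rintro y ⟨hyU, hy⟩
  suffices y ∈ Z ∩ U from this.1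
  rw [hS]
  refine ⟨hyU, ?_⟩
  by_contra hne
  have hc := hγ.continuousOn.continuousAt (hU.mem_nhds hyU)
  obtain ⟨z, ⟨hz1, hz2⟩, hzZ⟩ := mem_closure_iff_nhds.1 hy _
    ((hc.eventually_ne hne).and (hU.mem_nhds hyU))
  have : z ∈ Z ∩ U := ⟨hzZ, hz2⟩
  rw [hS] at this
  exact hz1 this.2

/-- Baire category step. -/
lemma aux_baire {D : ℕ} {F : Set (Fin D → ℝ)} (hF : IsLocallyClosed F) (hne : F.Nonempty)
    {J : Type} [Countable J] {Z : J → Set (Fin D → ℝ)} (hZ : ∀ j, IsLocallyClosed (Z j))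
    (hc : F ⊆ ⋃ j, Z j) :
    ∃ j, ∃ U, IsOpen U ∧ (F ∩ U).Nonempty ∧ F ∩ U ⊆ Z j := by
  choose V T hV hT hVT using hZ
  choose C hC hCV hCU _ using fun j => (hV j).exists_iUnion_isClosed
  have := hF.locallyCompactSpace
  have : Nonempty F := hne.to_subtype
  obtain ⟨⟨j, n⟩, hp⟩ := nonempty_interior_of_iUnion_of_closed (X := F) (ι := J × ℕ)
    (f := fun p => Subtype.val ⁻¹' (T p.1 ∩ C p.1 p.2))
    (fun p => ((hT p.1).inter (hC p.1 p.2)).preimage continuous_subtype_val) (by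
      refine eq_univ_of_forall fun x => ?_
      obtain ⟨j, hj⟩ := mem_iUnion.1 (hc x.2)
      rw [hVT j, ← hCU j] at hj
      obtain ⟨n, hn⟩ := mem_iUnion.1 hj.1
      exact mem_iUnion.2 ⟨(j, n), hj.2, hn⟩)
  obtain ⟨x, hx⟩ := hp
  obtain ⟨W, hW, hWo, hxW⟩ := mem_interior.1 hx
  obtain ⟨U, hU, rfl⟩ := isOpen_induced_iff.1 hWo
  refine ⟨j, U, hU, ⟨x, x.2, hxW⟩, ?_⟩
  rintro y ⟨hyF, hyU⟩
  have := hW (show (⟨y, hyF⟩ : F) ∈ Subtype.val ⁻¹' U from hyU)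
  rw [hVT j]
  exact ⟨hCV _ _ this.2, this.1⟩

lemma aux_defining_restrict {D : ℕ} {Ω S V U : Set (Fin D → ℝ)} {γ : (Fin D → ℝ) → ℝ}
    (hU : IsOpen U) (h : IsLocalDefining Ω S V γ) :
    IsLocalDefining U (S ∩ U) (V ∩ U) γ := by
  obtain ⟨hV, -, hγ, hd, hS⟩ := h
  refine ⟨hV.inter hU, inter_subset_right, hγ.mono inter_subset_left, fun y hy => hd y hy.1, ?_⟩
  ext y
  have := Set.ext_iff.1 hS y
  simp only [mem_inter_iff, mem_ofPred_eq] at this ⊢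
  tauto

lemma aux_inj.{u}
    {D : ℕ} (Ω S : Set (Fin D → ℝ)) (hΩ : IsOpen Ω)
    (a : (Fin D → ℝ) → (Fin D → ℝ)) (ha : ContDiffOn ℝ (⊤ : ℕ∞) a Ω)
    (hS : IsHypersurface Ω S) (hScl : closure S ∩ Ω ⊆ S)
    (J : Type) (hJ : Countable J) (Z : J → Set (Fin D → ℝ))
    (hZ : ∀ j, IsHypersurface Ω (Z j))
    (hZfin : ∀ j, ∀ x ∈ Z j, ∃ k : ℕ, x ∈ contactSet a Ω (Z j) k)
    (hcover : contactInf a Ω S ⊆ ⋃ j, Z j)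
    (hne : ∀ α : Ordinal.{u}, (Fset a Ω S α).Nonempty) :
    Function.Injective (Fset.{u} a Ω S) := by
  have hlt : ∀ α β : Ordinal.{u}, α < β → Fset a Ω S α ≠ Fset a Ω S β := by
    intro α β hαβ heq
    have h1 : Fset a Ω S α ⊆ Fset a Ω S (α + 1) := by
      rw [heq]
      exact aux_Fset_anti a Ω S β (α + 1) (Order.add_one_le_of_lt hαβ)
    have hsub : Fset a Ω S α ⊆ contactInf a Ω S := by
      rw [← aux_Fset_zero a Ω S]
      exact aux_Fset_anti a Ω S α 0 (zero_le)
    have hΩsub : Fset a Ω S α ⊆ Ω := fun x hx => hS.1 (hsub hx).1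
    have hlc : IsLocallyClosed (Fset a Ω S α) :=
      ⟨Ω, closure (Fset a Ω S α), hΩ, isClosed_closure,
        Subset.antisymm (fun x hx => ⟨hΩsub hx, subset_closure hx⟩)
          (fun x hx => aux_Fset_closed ha hS hScl α ⟨hx.2, hx.1⟩)⟩
    obtain ⟨j, U, hU, ⟨x, hxF, hxU⟩, hsubZ⟩ := aux_baire hlc (hne α)
      (fun j => aux_locallyClosed (hZ j)) (hsub.trans hcover)
    have h2 := h1 hxF
    rw [aux_Fset_succ] at h2
    apply h2.2
    obtain ⟨k, hxZ, V, γ, hVγ, hxV, hγ1, hγ2⟩ := hZfin j x (hsubZ ⟨hxF, hxU⟩)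
    have hUo : IsOpen (U ∩ Ω) := hU.inter hΩ
    have hxU' : x ∈ U ∩ Ω := ⟨hxU, hΩsub hxF⟩
    refine ⟨U ∩ Ω, Z j ∩ (U ∩ Ω), hUo, hxU', inter_subset_right,
      ⟨inter_subset_right, ?_⟩, fun y hy => ⟨hsubZ ⟨hy.1, hy.2.1⟩, hy.2⟩, k, ⟨hxZ, hxU'⟩,
      V ∩ (U ∩ Ω), γ, aux_defining_restrict hUo hVγ, ⟨hxV, hxU'⟩, hγ1, hγ2⟩
    intro y hy
    obtain ⟨V', γ', hV', hyV'⟩ := (hZ j).2 y hy.1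
    exact ⟨_, γ', aux_defining_restrict hUo hV', hyV', hy.2⟩
  intro α β h
  rcases lt_trichotomy α β with hl | he | hl
  · exact absurd h (hlt _ _ hl)
  · exact he
  · exact absurd h.symm (hlt _ _ hl)

/-- Proposition 3.7 of the paper: if `Σ(∞;H)` is covered by a finite or
countable family of hypersurfaces having only finite order contact with `H`, then
`F(α;H;Σ) = ∅` for some ordinal `α`. -/
theorem Fset_empty_of_countable_cover
    {D : ℕ} (hD : 1 ≤ D) (Ω S : Set (Fin D → ℝ)) (hΩ : IsOpen Ω)
    (a : (Fin D → ℝ) → (Fin D → ℝ)) (ha : ContDiffOn ℝ (⊤ : ℕ∞) a Ω)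
    (ha0 : ∀ x ∈ Ω, a x ≠ 0)
    (hS : IsHypersurface Ω S) (hScl : closure S ∩ Ω ⊆ S)
    (J : Type) (hJ : Countable J) (Z : J → Set (Fin D → ℝ))
    (hZ : ∀ j, IsHypersurface Ω (Z j))
    (hZfin : ∀ j, ∀ x ∈ Z j, ∃ k : ℕ, x ∈ contactSet a Ω (Z j) k)
    (hcover : contactInf a Ω S ⊆ ⋃ j, Z j) :
    ∃ α : Ordinal, Fset a Ω S α = ∅ := by
  by_contra! hne
  exact not_injective_of_ordinal _
    (aux_inj Ω S hΩ a ha hS hScl J hJ Z hZ hZfin hcover hne)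
end
end

section
/- Let X be a second-countable topological space, let κ be an ordinal, and let G be a function assigning to every ordinal β < κ a closed subset G(β) of X such that G(α) is strictly contained in G(β) whenever β < α < κ. Then κ is a countable ordinal. -/
/-- in a second-countable topological space, any strictly decreasing,
ordinal-indexed family of closed sets has countable length. -/
theorem countable_length_of_strict_decreasing_closed_chain
    {X : Type*} [TopologicalSpace X] [SecondCountableTopology X]
    (κ : Ordinal) (G : ∀ β : Ordinal, β < κ → Set X)
    (hclosed : ∀ β hβ, IsClosed (G β hβ))
    (hmono : ∀ β hβ α hα, β < α → G α hα ⊂ G β hβ) :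
    κ.card ≤ Cardinal.aleph0 := by
  have hlt : ∀ β : Ordinal, β < Order.succ β := fun β => Order.lt_succ β
  have key : ∀ β : Ordinal, ∃ U : Set X, ∀ hs : Order.succ β < κ,
      U ∈ TopologicalSpace.countableBasis X ∧
      (U ∩ G β ((hlt β).trans hs)).Nonempty ∧ U ∩ G (Order.succ β) hs = ∅ := by
    intro β
    by_cases hs : Order.succ β < κ
    · obtain ⟨x, hx, hx'⟩ := Set.exists_of_ssubset
        (hmono β ((hlt β).trans hs) _ hs (hlt β))
      obtain ⟨U, hU, hxU, hsub⟩ :=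
        (TopologicalSpace.isBasis_countableBasis X).exists_subset_of_mem_open
          (show x ∈ (G (Order.succ β) hs)ᶜ from hx') (hclosed _ hs).isOpen_compl
      refine ⟨U, fun _ => ⟨hU, ⟨x, hxU, hx⟩, ?_⟩⟩
      ext y
      simp only [Set.mem_inter_iff, Set.mem_empty_iff_false, iff_false, not_and]
      exact fun hy => hsub hy
    · exact ⟨∅, fun h => absurd h hs⟩
  choose U hU using key
  have aux : ∀ β α : Ordinal, Order.succ β < κ → Order.succ α < κ → β < α → U β ≠ U α := by
    intro β α hb ha hba he
    obtain ⟨-, -, h1⟩ := hU β hb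
    obtain ⟨-, ⟨x, hxU, hx⟩, -⟩ := hU α ha
    have hle : Order.succ β ≤ α := Order.succ_le_of_lt hba
    have hx2 : x ∈ G (Order.succ β) hb := by
      rcases hle.eq_or_lt with h | h
      · subst h; exact hx
      · exact (hmono _ hb _ _ h).1 hx
    have : x ∈ U β ∩ G (Order.succ β) hb := ⟨he ▸ hxU, hx2⟩
    rw [h1] at this
    exact this
  have hA : {β : Ordinal | Order.succ β < κ}.Countable := by
    refine Set.MapsTo.countable_of_injOn (f := U) (fun β hβ => (hU β hβ).1) ?_
      (TopologicalSpace.countable_countableBasis X)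
    intro β hb α ha he
    rcases lt_trichotomy β α with h | h | h
    · exact absurd he (aux _ _ hb ha h)
    · exact h
    · exact absurd he.symm (aux _ _ ha hb h)
  have hB : {β : Ordinal | Order.succ β = κ}.Countable := by
    apply Set.Subsingleton.countable
    intro a ha b hb
    exact Order.succ_injective (ha.trans hb.symm)
  have hC : (Set.Iio κ).Countable := by
    refine (hA.union hB).mono fun β hβ => ?_
    exact (Order.succ_le_of_lt (Set.mem_Iio.mp hβ)).lt_or_eq
  have := hC.le_aleph0
  rw [Cardinal.mk_Iio_ordinal] at this
  exact Cardinal.lift_le_aleph0.mp this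
end
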